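/- arXiv:1410.3298 — 4 statements merged into one kernel-verified Lean document; each statement's English description precedes it below -/
import Mathlib

section
/- Let Q = ∏_{k=1}^n [−R_k, R_k] ⊂ ℝⁿ be a compact cuboid with R_k > 0, let H be a C¹ function on an open neighborhood of Q, and let α, β¹, …, βⁿ be nonzero real numbers. For nonzero reals a₁, …, aₙ and M ∈ ℕ put F(t) := Σ_{l=0}^{M} 2^{iαlt} (H·χ_Q)(2^{β¹l}a₁, …, 2^{βⁿl}aₙ), where χ_Q is the indicator function of Q. Assume there are constants ε ∈ (0,1] and C₁, …, Cₙ ≥ 0 such that ∫₀¹ |(∂H/∂u_k)(su)| ds ≤ C_k |u_k|^{ε−1} for all u ∈ Q and k = 1, …, n. Then there is a constant C, depending only on Q, α, the β^k and ε, but not on H, the a_k, M or t, such that |F(t)| ≤ C(|H(0)| + Σ_{k=1}^n C_k)/|2^{iαt} − 1| for all real t with 2^{iαt} ≠ 1. In particular |F(t)| ≤ C‖H‖_{C¹(Q)}/|2^{iαt} − 1|. -/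
open MeasureTheory Set

noncomputable section

/-- `2^{iz} := e^{iz·log 2}`. -/
def twoPowI (z : ℝ) : ℂ := Complex.exp (Complex.I * z * Real.log 2)

/-- The cuboid `Q = ∏ₖ [-Rₖ, Rₖ] ⊆ ℝⁿ`. -/
def cuboid (n : ℕ) (R : Fin n → ℝ) : Set (Fin n → ℝ) :=
  Set.univ.pi fun k => Icc (-(R k)) (R k)

lemma twoPowI_mul_natCast (z : ℝ) (l : ℕ) : twoPowI (z * l) = twoPowI z ^ l := by
  rw [twoPowI, twoPowI, ← Complex.exp_nat_mul]
  push_cast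
  ring_nf

lemma norm_twoPowI (z : ℝ) : ‖twoPowI z‖ = 1 := by
  rw [twoPowI, mul_assoc, ← Complex.ofReal_mul, mul_comm, Complex.norm_exp_ofReal_mul_I]

lemma norm_sum_pow_mul_norm_sub_one_le {z : ℂ} (hz : ‖z‖ = 1) (S : Finset ℕ)
    (hS : (S : Set ℕ).OrdConnected) : ‖∑ l ∈ S, z ^ l‖ * ‖z - 1‖ ≤ 2 := by
  rcases S.eq_empty_or_nonempty with rfl | hne
  · simp
  have hIco : S = Finset.Ico (S.min' hne) (S.max' hne + 1) := by
    ext l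
    rw [Finset.mem_Ico, Nat.lt_succ_iff]
    exact ⟨fun h => ⟨S.min'_le l h, S.le_max' l h⟩,
      fun h => hS.out (S.min'_mem hne) (S.max'_mem hne) h⟩
  have hle : S.min' hne ≤ S.max' hne + 1 :=
    (S.min'_le _ (S.max'_mem hne)).trans (Nat.le_succ _)
  rw [← norm_mul, hIco, Finset.sum_Ico_eq_sub _ hle, sub_mul, geom_sum_mul, geom_sum_mul,
    sub_sub_sub_cancel_right]
  refine (norm_sub_le _ _).trans ?_
  rw [norm_pow, norm_pow, hz, one_pow, one_pow]
  norm_num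

lemma sum_mul_pow_le_of_forall_le {r A B : ℝ} (hr : 0 < r) (hr1 : r ≠ 1) (hB : 0 ≤ B)
    (S : Finset ℕ) (hS : ∀ l ∈ S, A * r ^ l ≤ B) :
    ∑ l ∈ S, A * r ^ l ≤ B * (1 - min r r⁻¹)⁻¹ := by
  have hq0 : 0 ≤ min r r⁻¹ := le_min hr.le (inv_pos.2 hr).le
  have hq1 : min r r⁻¹ < 1 := by
    rcases lt_or_gt_of_ne hr1 with h | h
    · exact (min_le_left _ _).trans_lt h
    · exact (min_le_right _ _).trans_lt (inv_lt_one_of_one_lt₀ h)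
  have of_exponent (φ : ℕ → ℕ) (hφ : Set.InjOn φ S)
      (h : ∀ l ∈ S, A * r ^ l ≤ B * (min r r⁻¹) ^ φ l) :
      ∑ l ∈ S, A * r ^ l ≤ B * (1 - min r r⁻¹)⁻¹ := by
    refine (Finset.sum_le_sum h).trans ?_
    rw [← Finset.mul_sum, ← Finset.sum_image (f := fun j => (min r r⁻¹) ^ j) hφ,
      ← tsum_geometric_of_lt_one hq0 hq1]
    gcongr
    exact (summable_geometric_of_lt_one hq0 hq1).sum_le_tsum _ fun _ _ => pow_nonneg hq0 _
  rcases S.eq_empty_or_nonempty with rfl | hne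
  · rw [Finset.sum_empty]
    exact mul_nonneg hB (inv_nonneg.2 (sub_nonneg.2 hq1.le))
  rcases lt_or_gt_of_ne hr1 with h | h
  · have hmin : min r r⁻¹ = r := min_eq_left (h.le.trans (one_le_inv₀ hr |>.2 h.le))
    refine of_exponent (fun l => l - S.min' hne) (fun x hx y hy hxy => ?_) fun l hl => ?_
    · have := S.min'_le x hx
      have := S.min'_le y hy
      simp only at hxy
      omega
    · rw [hmin]
      calc A * r ^ l = A * r ^ S.min' hne * r ^ (l - S.min' hne) := by
            rw [mul_assoc, ← pow_add, Nat.add_sub_cancel' (S.min'_le l hl)]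
        _ ≤ _ := by
            gcongr
            exact hS _ (S.min'_mem hne)
  · have hmin : min r r⁻¹ = r⁻¹ := min_eq_right ((inv_le_one_of_one_le₀ h.le).trans h.le)
    refine of_exponent (fun l => S.max' hne - l) (fun x hx y hy hxy => ?_) fun l hl => ?_
    · have := S.le_max' x hx
      have := S.le_max' y hy
      simp only at hxy
      omega
    · rw [hmin]
      calc A * r ^ l = A * r ^ S.max' hne * r⁻¹ ^ (S.max' hne - l) := by
            conv_rhs => rw [← Nat.add_sub_cancel' (S.le_max' l hl), pow_add]
            rw [Nat.add_sub_cancel' (S.le_max' l hl), inv_pow]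
            field_simp
        _ ≤ _ := by
            gcongr
            exact hS _ (S.max'_mem hne)

lemma abs_dilate_rpow (b ε a : ℝ) (l : ℕ) :
    |(2 : ℝ) ^ (b * l) * a| ^ ε = |a| ^ ε * ((2 : ℝ) ^ (b * ε)) ^ l := by
  rw [abs_mul, abs_of_pos (Real.rpow_pos_of_pos two_pos _),
    Real.mul_rpow (Real.rpow_nonneg zero_le_two _) (abs_nonneg _),
    ← Real.rpow_mul zero_le_two, ← Real.rpow_natCast, ← Real.rpow_mul zero_le_two, mul_comm]
  ring_nf

lemma mem_cuboid_iff {n : ℕ} {R u : Fin n → ℝ} : u ∈ cuboid n R ↔ ∀ k, |u k| ≤ R k := by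
  simp only [cuboid, Set.mem_univ_pi, Set.mem_Icc, abs_le]

lemma smul_mem_cuboid {n : ℕ} {R u : Fin n → ℝ} (hu : u ∈ cuboid n R) {s : ℝ}
    (hs : s ∈ Icc (0 : ℝ) 1) : s • u ∈ cuboid n R := by
  rw [mem_cuboid_iff] at hu ⊢
  intro k
  rw [Pi.smul_apply, smul_eq_mul, abs_mul, abs_of_nonneg hs.1]
  exact (mul_le_of_le_one_left (abs_nonneg _) hs.2).trans (hu k)

lemma ordConnected_setOf_dilate_mem_cuboid {n : ℕ} (R β a : Fin n → ℝ) :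
    {l : ℕ | (fun k => (2 : ℝ) ^ (β k * l) * a k) ∈ cuboid n R}.OrdConnected := by
  refine ⟨fun x hx y hy l hl => ?_⟩
  rw [Set.mem_ofPred_eq, mem_cuboid_iff] at *
  intro k
  have hxl : (x : ℝ) ≤ l := Nat.cast_le.2 hl.1
  have hly : (l : ℝ) ≤ y := Nat.cast_le.2 hl.2
  have habs (b : ℝ) : |(2 : ℝ) ^ b * a k| = (2 : ℝ) ^ b * |a k| := by
    rw [abs_mul, abs_of_pos (Real.rpow_pos_of_pos two_pos _)]
  rcases le_total 0 (β k) with hβ | hβ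
  · refine le_trans ?_ (hy k)
    rw [habs, habs]
    gcongr
    norm_num
  · refine le_trans ?_ (hx k)
    rw [habs, habs]
    refine mul_le_mul_of_nonneg_right ?_ (abs_nonneg _)
    exact Real.rpow_le_rpow_of_exponent_le one_le_two (mul_le_mul_of_nonpos_left hxl hβ)

lemma norm_sub_zero_le_of_integral_partial_le {n : ℕ} {ε : ℝ} {R : Fin n → ℝ}
    {H : (Fin n → ℝ) → ℂ} {U : Set (Fin n → ℝ)} {Cc : Fin n → ℝ} (hU : IsOpen U)
    (hQU : cuboid n R ⊆ U) (hH : ContDiffOn ℝ 1 H U) {u : Fin n → ℝ} (hu : u ∈ cuboid n R)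
    (hu0 : ∀ k, u k ≠ 0)
    (hC : ∀ k, (∫ s in Icc (0 : ℝ) 1, ‖fderiv ℝ H (s • u) (Pi.single k 1)‖)
      ≤ Cc k * |u k| ^ (ε - 1)) :
    ‖H u - H 0‖ ≤ ∑ k, Cc k * |u k| ^ ε := by
  have hmem (s : ℝ) (hs : s ∈ Icc (0 : ℝ) 1) : s • u ∈ U := hQU (smul_mem_cuboid hu hs)
  have hcont : ContinuousOn (fun s : ℝ => fderiv ℝ H (s • u)) (Icc 0 1) :=
    (hH.continuousOn_fderiv_of_isOpen hU le_rfl).comp (by fun_prop) hmem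
  have hderiv (s : ℝ) (hs : s ∈ uIcc (0 : ℝ) 1) :
      HasDerivAt (fun s : ℝ => H (s • u)) (fderiv ℝ H (s • u) u) s := by
    rw [uIcc_of_le zero_le_one] at hs
    have hd : DifferentiableAt ℝ H (s • u) :=
      (hH.differentiableOn one_ne_zero).differentiableAt (hU.mem_nhds (hmem s hs))
    have := hd.hasFDerivAt.comp_hasDerivAt s ((hasDerivAt_id s).smul_const u)
    simpa [Function.comp_def] using this
  have hftc : ∫ s in (0 : ℝ)..1, fderiv ℝ H (s • u) u = H u - H 0 := by
    have hint : IntervalIntegrable (fun s : ℝ => fderiv ℝ H (s • u) u) volume 0 1 := by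
      apply ContinuousOn.intervalIntegrable
      rw [uIcc_of_le zero_le_one]
      exact hcont.clm_apply continuousOn_const
    simpa using intervalIntegral.integral_eq_sub_of_hasDerivAt hderiv hint
  have hint (k : Fin n) : IntegrableOn
      (fun s : ℝ => |u k| * ‖fderiv ℝ H (s • u) (Pi.single k 1)‖) (Icc 0 1) :=
    (continuousOn_const.mul (hcont.clm_apply continuousOn_const).norm).integrableOn_compact
      isCompact_Icc
  have hpoint (s : ℝ) : ‖fderiv ℝ H (s • u) u‖
      ≤ ∑ k, |u k| * ‖fderiv ℝ H (s • u) (Pi.single k 1)‖ := by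
    have hsum : fderiv ℝ H (s • u) u
        = ∑ k, u k • fderiv ℝ H (s • u) (Pi.single k 1) := by
      conv_lhs => enter [2]; rw [pi_eq_sum_univ' u]
      simp_rw [map_sum, map_smul]
    rw [hsum]
    refine (norm_sum_le _ _).trans (Finset.sum_le_sum fun k _ => ?_)
    rw [norm_smul, Real.norm_eq_abs]
  rw [← hftc, intervalIntegral.integral_of_le zero_le_one, ← integral_Icc_eq_integral_Ioc]
  calc ‖∫ s in Icc (0 : ℝ) 1, fderiv ℝ H (s • u) u‖
      ≤ ∫ s in Icc (0 : ℝ) 1, ∑ k, |u k| * ‖fderiv ℝ H (s • u) (Pi.single k 1)‖ :=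
        norm_integral_le_of_norm_le (integrable_finsetSum _ fun k _ => hint k)
          (Filter.Eventually.of_forall hpoint)
    _ = ∑ k, |u k| * ∫ s in Icc (0 : ℝ) 1, ‖fderiv ℝ H (s • u) (Pi.single k 1)‖ := by
        rw [integral_finsetSum _ fun k _ => hint k]
        simp_rw [integral_const_mul]
    _ ≤ ∑ k, |u k| * (Cc k * |u k| ^ (ε - 1)) := by
        gcongr with k
        exact hC k
    _ = ∑ k, Cc k * |u k| ^ ε := by
        refine Finset.sum_congr rfl fun k _ => ?_
        rw [Real.rpow_sub_one (abs_ne_zero.2 (hu0 k))]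
        have := abs_ne_zero.2 (hu0 k)
        field_simp

/-- The bound for `∑ₗ |2^{bl} a|^ε` over those `l` with `|2^{bl} a| ≤ R`. -/
def dyadicBound (ε R b : ℝ) : ℝ :=
  R ^ ε * (1 - min ((2 : ℝ) ^ (b * ε)) ((2 : ℝ) ^ (b * ε))⁻¹)⁻¹

lemma sum_abs_dilate_rpow_le {ε R b : ℝ} (hε : 0 < ε) (hR : 0 < R) (hb : b ≠ 0) (a : ℝ)
    (S : Finset ℕ) (hS : ∀ l ∈ S, |(2 : ℝ) ^ (b * l) * a| ≤ R) :
    ∑ l ∈ S, |(2 : ℝ) ^ (b * l) * a| ^ ε ≤ dyadicBound ε R b := by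
  have hr1 : (2 : ℝ) ^ (b * ε) ≠ 1 := by
    rcases lt_or_gt_of_ne (mul_ne_zero hb hε.ne') with h | h
    · exact (Real.rpow_lt_one_of_one_lt_of_neg one_lt_two h).ne
    · exact (Real.one_lt_rpow one_lt_two h).ne'
  simp_rw [abs_dilate_rpow]
  refine sum_mul_pow_le_of_forall_le (Real.rpow_pos_of_pos two_pos _) hr1
    (Real.rpow_nonneg hR.le _) S fun l hl => ?_
  rw [← abs_dilate_rpow]
  exact Real.rpow_le_rpow (abs_nonneg _) (hS l hl) hε.le

lemma dyadicBound_nonneg {ε R b : ℝ} (hε : 0 < ε) (hR : 0 < R) (hb : b ≠ 0) :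
    0 ≤ dyadicBound ε R b := by
  simpa using sum_abs_dilate_rpow_le hε hR hb 0 ∅ (by simp)

lemma norm_dyadic_sum_mul_le {n : ℕ} {R β : Fin n → ℝ} {ε : ℝ} (hR : ∀ k, 0 < R k)
    (hβ : ∀ k, β k ≠ 0) (hε : 0 < ε) {H : (Fin n → ℝ) → ℂ} {Cc a : Fin n → ℝ}
    (hCc : ∀ k, 0 ≤ Cc k) (ha : ∀ k, a k ≠ 0)
    (hH : ∀ u ∈ cuboid n R, (∀ k, u k ≠ 0) → ‖H u - H 0‖ ≤ ∑ k, Cc k * |u k| ^ ε)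
    (M : ℕ) (α t : ℝ) :
    ‖∑ l ∈ Finset.range (M + 1), twoPowI (α * l * t) *
        Set.indicator (cuboid n R) H (fun k => (2 : ℝ) ^ (β k * l) * a k)‖
        * ‖twoPowI (α * t) - 1‖
      ≤ 2 * (1 + ∑ k, dyadicBound ε (R k) (β k)) * (‖H 0‖ + ∑ k, Cc k) := by
  classical
  set z := twoPowI (α * t)
  have hz : ‖z‖ = 1 := norm_twoPowI _
  have hz2 : ‖z - 1‖ ≤ 2 := (norm_sub_le _ _).trans (by rw [hz, norm_one]; norm_num)
  set x : ℕ → Fin n → ℝ := fun l k => (2 : ℝ) ^ (β k * l) * a k with hx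
  set S := (Finset.range (M + 1)).filter fun l => x l ∈ cuboid n R with hSdef
  have hSmem (l : ℕ) (hl : l ∈ S) : x l ∈ cuboid n R := (Finset.mem_filter.1 hl).2
  have hS : (S : Set ℕ).OrdConnected := by
    have : (S : Set ℕ) = Set.Iio (M + 1) ∩ {l | x l ∈ cuboid n R} := by
      ext l
      simp [hSdef]
    rw [this]
    exact Set.ordConnected_Iio.inter (ordConnected_setOf_dilate_mem_cuboid R β a)
  have hsplit : ∑ l ∈ Finset.range (M + 1), twoPowI (α * l * t) *
        Set.indicator (cuboid n R) H (x l)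
      = (∑ l ∈ S, z ^ l) * H 0 + ∑ l ∈ S, z ^ l * (H (x l) - H 0) := by
    rw [Finset.sum_mul, ← Finset.sum_add_distrib, Finset.sum_filter]
    refine Finset.sum_congr rfl fun l _ => ?_
    rw [mul_right_comm, twoPowI_mul_natCast, Set.indicator_apply]
    split_ifs <;> ring
  have hremainder : ‖∑ l ∈ S, z ^ l * (H (x l) - H 0)‖
      ≤ ∑ k, Cc k * dyadicBound ε (R k) (β k) :=
    calc ‖∑ l ∈ S, z ^ l * (H (x l) - H 0)‖
        ≤ ∑ l ∈ S, ∑ k, Cc k * |x l k| ^ ε := by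
          refine (norm_sum_le _ _).trans (Finset.sum_le_sum fun l hl => ?_)
          rw [norm_mul, norm_pow, hz, one_pow, one_mul]
          exact hH _ (hSmem l hl) fun k =>
            mul_ne_zero (Real.rpow_pos_of_pos two_pos _).ne' (ha k)
      _ = ∑ k, Cc k * ∑ l ∈ S, |x l k| ^ ε := by
          rw [Finset.sum_comm]
          simp_rw [Finset.mul_sum]
      _ ≤ _ := by
          refine Finset.sum_le_sum fun k _ => mul_le_mul_of_nonneg_left ?_ (hCc k)
          exact sum_abs_dilate_rpow_le hε (hR k) (hβ k) (a k) S fun l hl =>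
            mem_cuboid_iff.1 (hSmem l hl) k
  have hD (k : Fin n) : 0 ≤ dyadicBound ε (R k) (β k) := dyadicBound_nonneg hε (hR k) (hβ k)
  have hprod : ∑ k, Cc k * dyadicBound ε (R k) (β k)
      ≤ (∑ k, Cc k) * ∑ k, dyadicBound ε (R k) (β k) := by
    rw [Finset.sum_mul]
    refine Finset.sum_le_sum fun k _ => mul_le_mul_of_nonneg_left ?_ (hCc k)
    exact Finset.single_le_sum (fun j _ => hD j) (Finset.mem_univ k)
  have hCsum : 0 ≤ ∑ k, Cc k := Finset.sum_nonneg fun k _ => hCc k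
  have hDsum : 0 ≤ ∑ k, dyadicBound ε (R k) (β k) := Finset.sum_nonneg fun k _ => hD k
  rw [hsplit]
  calc ‖(∑ l ∈ S, z ^ l) * H 0 + ∑ l ∈ S, z ^ l * (H (x l) - H 0)‖ * ‖z - 1‖
      ≤ (‖(∑ l ∈ S, z ^ l)‖ * ‖H 0‖ + ∑ k, Cc k * dyadicBound ε (R k) (β k)) * ‖z - 1‖ := by
        gcongr
        refine (norm_add_le _ _).trans ?_
        rw [norm_mul]
        gcongr
    _ = ‖(∑ l ∈ S, z ^ l)‖ * ‖z - 1‖ * ‖H 0‖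
        + (∑ k, Cc k * dyadicBound ε (R k) (β k)) * ‖z - 1‖ := by ring
    _ ≤ 2 * ‖H 0‖ + ((∑ k, Cc k) * ∑ k, dyadicBound ε (R k) (β k)) * 2 := by
        gcongr
        exact norm_sum_pow_mul_norm_sub_one_le hz S hS
    _ ≤ _ := by nlinarith [mul_nonneg hDsum (norm_nonneg (H 0))]

lemma integral_norm_partial_le {n : ℕ} {R : Fin n → ℝ} {ε K : ℝ} (hε : ε ≤ 1) (hK : 0 ≤ K)
    {H : (Fin n → ℝ) → ℂ} (hHK : ∀ u ∈ cuboid n R, ‖fderiv ℝ H u‖ ≤ K) {u : Fin n → ℝ}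
    (hu : u ∈ cuboid n R) (k : Fin n) (hk : u k ≠ 0) :
    (∫ s in Icc (0 : ℝ) 1, ‖fderiv ℝ H (s • u) (Pi.single k 1)‖)
      ≤ K * R k ^ (1 - ε) * |u k| ^ (ε - 1) := by
  have hpos : 0 < |u k| := abs_pos.2 hk
  have hle : (∫ s in Icc (0 : ℝ) 1, ‖fderiv ℝ H (s • u) (Pi.single k 1)‖) ≤ K := by
    have hbound : ∀ s ∈ Icc (0 : ℝ) 1, ‖‖fderiv ℝ H (s • u) (Pi.single k 1)‖‖ ≤ K := by
      intro s hs
      rw [norm_norm]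
      refine (ContinuousLinearMap.le_opNorm _ _).trans ?_
      rw [Pi.norm_single, norm_one, mul_one]
      exact hHK _ (smul_mem_cuboid hu hs)
    refine (Real.le_norm_self _).trans ?_
    simpa using norm_setIntegral_le_of_norm_le_const (μ := volume) measure_Icc_lt_top hbound
  refine hle.trans ?_
  rw [mul_assoc]
  refine le_mul_of_one_le_right hK ?_
  calc (1 : ℝ) = |u k| ^ (1 - ε) * |u k| ^ (ε - 1) := by
        rw [← Real.rpow_add hpos, sub_add_sub_cancel', sub_self, Real.rpow_zero]
    _ ≤ R k ^ (1 - ε) * |u k| ^ (ε - 1) := by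
        gcongr
        exact mem_cuboid_iff.1 hu k

/-- the oscillatory-sum lemma. For a compact cuboid `Q`, nonzero reals
`α, β¹, …, βⁿ` and `ε ∈ (0,1]`, there is a constant `C` (independent of `H`, the `aₖ`,
`M` and `t`) such that for every `C¹` function `H` on a neighborhood of `Q` satisfying
`∫₀¹ |(∂H/∂uₖ)(su)| ds ≤ Cₖ |uₖ|^{ε-1}` on `Q`, the sum
`F(t) = Σ_{l=0}^M 2^{iαlt} (H·χ_Q)(2^{β¹l}a₁, …, 2^{βⁿl}aₙ)` satisfies
`|F(t)| ≤ C(|H(0)| + Σ Cₖ)/|2^{iαt} - 1|`; in particular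
`|F(t)| ≤ C‖H‖_{C¹(Q)}/|2^{iαt} - 1|`. -/
theorem stmt2 (n : ℕ) (R : Fin n → ℝ) (hR : ∀ k, 0 < R k)
    (α : ℝ) (β : Fin n → ℝ) (hα : α ≠ 0) (hβ : ∀ k, β k ≠ 0)
    (ε : ℝ) (hε : ε ∈ Ioc (0:ℝ) 1) :
    ∃ C : ℝ, 0 < C ∧
      ∀ (H : (Fin n → ℝ) → ℂ) (U : Set (Fin n → ℝ)) (Cc : Fin n → ℝ),
        IsOpen U → cuboid n R ⊆ U → ContDiffOn ℝ 1 H U →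
        (∀ k, 0 ≤ Cc k) →
        (∀ u ∈ cuboid n R, ∀ k, u k ≠ 0 →
          (∫ s in Icc (0:ℝ) 1, ‖fderiv ℝ H (s • u) (Pi.single k 1)‖)
            ≤ Cc k * |u k| ^ (ε - 1)) →
        ∀ (a : Fin n → ℝ), (∀ k, a k ≠ 0) → ∀ (M : ℕ) (t : ℝ),
          twoPowI (α * t) ≠ 1 →
          (‖∑ l ∈ Finset.range (M + 1), twoPowI (α * l * t) *
              Set.indicator (cuboid n R) H (fun k => (2:ℝ) ^ (β k * l) * a k)‖
            ≤ C * (‖H 0‖ + ∑ k, Cc k) / ‖twoPowI (α * t) - 1‖)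
          ∧ ∀ K : ℝ, (∀ u ∈ cuboid n R, ‖H u‖ + ‖fderiv ℝ H u‖ ≤ K) →
              ‖∑ l ∈ Finset.range (M + 1), twoPowI (α * l * t) *
                  Set.indicator (cuboid n R) H (fun k => (2:ℝ) ^ (β k * l) * a k)‖
                ≤ C * K / ‖twoPowI (α * t) - 1‖ := by
  have hD : 0 ≤ ∑ k, dyadicBound ε (R k) (β k) :=
    Finset.sum_nonneg fun k _ => dyadicBound_nonneg hε.1 (hR k) (hβ k)
  have hRsum : 0 ≤ ∑ k, R k ^ (1 - ε) :=
    Finset.sum_nonneg fun k _ => Real.rpow_nonneg (hR k).le _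
  set D := 2 * (1 + ∑ k, dyadicBound ε (R k) (β k))
  have hDpos : 0 < D := by positivity
  refine ⟨D * (1 + ∑ k, R k ^ (1 - ε)), by positivity, ?_⟩
  intro H U Cc hU hQU hH hCc hint a ha M t ht
  have hz : 0 < ‖twoPowI (α * t) - 1‖ := norm_pos_iff.2 (sub_ne_zero.2 ht)
  have main (c : Fin n → ℝ) (hc : ∀ k, 0 ≤ c k)
      (hcint : ∀ u ∈ cuboid n R, ∀ k, u k ≠ 0 →
        (∫ s in Icc (0 : ℝ) 1, ‖fderiv ℝ H (s • u) (Pi.single k 1)‖)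
          ≤ c k * |u k| ^ (ε - 1)) :=
    norm_dyadic_sum_mul_le hR hβ hε.1 hc ha
      (fun u hu hu0 => norm_sub_zero_le_of_integral_partial_le hU hQU hH hu hu0
        fun k => hcint u hu k (hu0 k)) M α t
  refine ⟨?_, fun K hK => ?_⟩
  · rw [le_div_iff₀ hz]
    refine (main Cc hCc hint).trans ?_
    have : 0 ≤ ‖H 0‖ + ∑ k, Cc k := add_nonneg (norm_nonneg _) (Finset.sum_nonneg fun k _ => hCc k)
    exact mul_le_mul_of_nonneg_right (le_mul_of_one_le_right hDpos.le (by linarith)) this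
  · have h0 := hK 0 (mem_cuboid_iff.2 fun k => by simpa using (hR k).le)
    have hH0 : ‖H 0‖ ≤ K := by linarith [norm_nonneg (fderiv ℝ H 0)]
    have hK0 : 0 ≤ K := (norm_nonneg _).trans hH0
    rw [le_div_iff₀ hz]
    refine (main (fun k => K * R k ^ (1 - ε))
      (fun k => mul_nonneg hK0 (Real.rpow_nonneg (hR k).le _))
      fun u hu k hk => integral_norm_partial_le hε.2 hK0
        (fun v hv => by linarith [hK v hv, norm_nonneg (H v)]) hu k hk).trans ?_
    rw [← Finset.mul_sum, mul_assoc D]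
    refine mul_le_mul_of_nonneg_left ?_ hDpos.le
    linarith
end
end

section
/- Let β₁, …, βₙ ∈ (0,∞) be pairwise distinct positive real numbers. Then there exist constants C₁ and C₂, depending only on β₁, …, βₙ, with the following property: for any complex numbers α₁, …, αₙ, let Λ denote the set of all dyadic numbers λ = 2^j (j ∈ ℤ) such that max_{1 ≤ k ≤ n} λ^{β_k}|α_k| ≥ 1. Then there is a subset Λ_e ⊆ Λ of cardinality at most C₁ such that |Σ_{k=1}^n λ^{β_k} α_k| ≥ 2/3 for every λ ∈ Λ ∖ Λ_e, and Σ_{λ ∈ Λ∖Λ_e} |Σ_{k=1}^n λ^{β_k} α_k|^{−1} ≤ C₂. -/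
open scoped Classical

theorem zpow_rpow_comm {x : ℝ} (hx : 0 ≤ x) (j : ℤ) (b : ℝ) : (x ^ j) ^ b = (x ^ b) ^ j := by
  rw [← Real.rpow_intCast, ← Real.rpow_intCast, ← Real.rpow_mul hx, ← Real.rpow_mul hx, mul_comm]

theorem exists_Icc_of_zpow_comparable_of_lt {b c : ℝ} (hb : 0 < b) (hbc : b < c) {M : ℝ}
    (hM : 0 ≤ M) :
    ∃ N : ℕ, ∀ A B : ℝ, 0 < B → ∃ j₀ : ℤ, ∀ j : ℤ,
      b ^ j * A ≤ M * (c ^ j * B) → c ^ j * B ≤ M * (b ^ j * A) →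
      j ∈ Finset.Icc (j₀ - N) (j₀ + N) := by
  have hr : 1 < c / b := (one_lt_div hb).2 hbc
  obtain ⟨N, hN⟩ := pow_unbounded_of_one_lt (M ^ 2) hr
  refine ⟨N, fun A B hB => ?_⟩
  have key : ∀ i j : ℤ, b ^ i * A ≤ M * (c ^ i * B) → c ^ j * B ≤ M * (b ^ j * A) →
      j ≤ i + N := by
    intro i j hi hj
    have hc (m : ℤ) : c ^ m = b ^ m * (c / b) ^ m := by
      rw [← mul_zpow, mul_div_cancel₀ _ hb.ne']
    have hA : A ≤ M * ((c / b) ^ i * B) := by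
      refine le_of_mul_le_mul_left ?_ (zpow_pos hb i)
      rw [hc i] at hi
      linarith
    have hB' : (c / b) ^ j * B ≤ M * A := by
      refine le_of_mul_le_mul_left ?_ (zpow_pos hb j)
      rw [hc j] at hj
      linarith
    have hle : (c / b) ^ j ≤ M ^ 2 * (c / b) ^ i := by
      refine le_of_mul_le_mul_right ?_ hB
      nlinarith [mul_le_mul_of_nonneg_left hA hM]
    have hri : 0 < (c / b) ^ i := zpow_pos (zero_lt_one.trans hr) i
    have hlt : (c / b) ^ j < (c / b) ^ (i + N) := by
      rw [zpow_add₀ (zero_lt_one.trans hr).ne', zpow_natCast]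
      nlinarith
    exact ((zpow_lt_zpow_iff_right₀ hr).1 hlt).le
  by_cases h : ∃ i : ℤ, b ^ i * A ≤ M * (c ^ i * B) ∧ c ^ i * B ≤ M * (b ^ i * A)
  · obtain ⟨i, hi, hi'⟩ := h
    refine ⟨i, fun j hj hj' => Finset.mem_Icc.2 ⟨?_, key i j hi hj'⟩⟩
    have := key j i hj hi'
    omega
  · exact ⟨0, fun j hj hj' => (h ⟨j, hj, hj'⟩).elim⟩

/-- Two geometric progressions with distinct ratios are comparable up to the factor `M` only for
exponents in an interval of length bounded independently of the initial values. -/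
theorem exists_Icc_of_zpow_comparable {b c : ℝ} (hb : 0 < b) (hc : 0 < c) (hbc : b ≠ c) {M : ℝ}
    (hM : 0 ≤ M) :
    ∃ N : ℕ, ∀ A B : ℝ, 0 < A → 0 < B → ∃ j₀ : ℤ, ∀ j : ℤ,
      b ^ j * A ≤ M * (c ^ j * B) → c ^ j * B ≤ M * (b ^ j * A) →
      j ∈ Finset.Icc (j₀ - N) (j₀ + N) := by
  rcases lt_or_gt_of_ne hbc with h | h
  · obtain ⟨N, hN⟩ := exists_Icc_of_zpow_comparable_of_lt hb h hM
    exact ⟨N, fun A B _ hB => hN A B hB⟩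
  · obtain ⟨N, hN⟩ := exists_Icc_of_zpow_comparable_of_lt hc h hM
    refine ⟨N, fun A B hA _ => ?_⟩
    obtain ⟨j₀, hj₀⟩ := hN B A hA
    exact ⟨j₀, fun j h₁ h₂ => hj₀ j h₂ h₁⟩

/-- The inverses of those terms of a geometric progression that are at least `1` are dominated by
a convergent geometric series whose sum only depends on the ratio. -/
theorem exists_hasSum_ge_inv_zpow_mul {b : ℝ} (hb : 1 < b) {A : ℝ} (hA : 0 ≤ A) :
    ∃ g : ℤ → ℝ, HasSum g (1 - b⁻¹)⁻¹ ∧ (∀ j, 0 ≤ g j) ∧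
      ∀ j : ℤ, 1 ≤ b ^ j * A → (b ^ j * A)⁻¹ ≤ g j := by
  have hb0 : 0 < b := zero_lt_one.trans hb
  obtain ⟨j₀, hj₀⟩ : ∃ j₀ : ℤ, ∀ j : ℤ, 1 ≤ b ^ j * A → j₀ ≤ j ∧ 1 ≤ b ^ j₀ * A := by
    rcases hA.eq_or_lt with rfl | hA
    · exact ⟨0, fun j hj => absurd hj (by simp)⟩
    · obtain ⟨m, hm, hm'⟩ := exists_mem_Ioc_zpow (inv_pos.2 hA) hb
      rw [inv_le_iff_one_le_mul₀ hA] at hm'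
      refine ⟨m + 1, fun j hj => ⟨?_, hm'⟩⟩
      rw [← inv_le_iff_one_le_mul₀ hA] at hj
      exact (zpow_lt_zpow_iff_right₀ hb).1 (hm.trans_le hj)
  have hinj : Function.Injective (fun m : ℕ => j₀ + (m : ℤ)) := fun m m' h => by
    simpa using h
  refine ⟨fun j => if j₀ ≤ j then b⁻¹ ^ (j - j₀) else 0, ?_, fun j => ?_, fun j hj => ?_⟩
  · rw [← hinj.hasSum_iff]
    · have := hasSum_geometric_of_lt_one (inv_pos.2 hb0).le (inv_lt_one_of_one_lt₀ hb)
      convert this using 2 with m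
      simp
    · intro j hj
      refine if_neg fun h => hj ⟨(j - j₀).toNat, ?_⟩
      simp only
      omega
  · dsimp only
    split_ifs <;> positivity
  · obtain ⟨h, h'⟩ := hj₀ j hj
    simp only [if_pos h, inv_zpow]
    refine inv_anti₀ (zpow_pos hb0 _) ?_
    rw [zpow_sub₀ hb0.ne', div_le_iff₀ (zpow_pos hb0 _), mul_assoc, mul_comm A]
    exact le_mul_of_one_le_right (zpow_pos hb0 _).le h'

/-- If one summand dominates `3 n` times every other one, it controls the whole sum. -/
theorem two_thirds_mul_norm_le_norm_sum {n : ℕ} (z : Fin n → ℂ) (m : Fin n)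
    (h : ∀ k, k ≠ m → 3 * n * ‖z k‖ ≤ ‖z m‖) : 2 / 3 * ‖z m‖ ≤ ‖∑ k, z k‖ := by
  have hn : (0 : ℝ) < n := by exact_mod_cast m.pos
  have hrest : ‖∑ k ∈ Finset.univ.erase m, z k‖ ≤ ‖z m‖ / 3 := by
    calc ‖∑ k ∈ Finset.univ.erase m, z k‖
        ≤ ∑ k ∈ Finset.univ.erase m, ‖z m‖ / (3 * n) := by
          refine norm_sum_le_of_le _ fun k hk => ?_
          rw [le_div_iff₀ (by positivity), mul_comm]
          exact h k (Finset.ne_of_mem_erase hk)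
      _ ≤ ∑ _k : Fin n, ‖z m‖ / (3 * n) :=
          Finset.sum_le_sum_of_subset_of_nonneg (Finset.erase_subset _ _)
            fun _ _ _ => by positivity
      _ = ‖z m‖ / 3 := by
          simp only [Finset.sum_const, Finset.card_univ, Fintype.card_fin, nsmul_eq_mul]
          field_simp
  rw [← Finset.add_sum_erase _ _ (Finset.mem_univ m)]
  have := norm_sub_le_norm_add (z m) (∑ k ∈ Finset.univ.erase m, z k)
  linarith

/-- for pairwise distinct positive `β₁, …, βₙ` there are constants `C₁, C₂`,
depending only on the `β`'s, such that for all complex `α₁, …, αₙ`, letting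
`Λ = {2^j : max_k (2^j)^{β_k}|α_k| ≥ 1}`, there is an exceptional `Λₑ ⊆ Λ` of cardinality
at most `C₁` with `|Σ_k (2^j)^{β_k} α_k| ≥ 2/3` for `2^j ∈ Λ ∖ Λₑ`, and
`Σ_{Λ∖Λₑ} |Σ_k (2^j)^{β_k} α_k|⁻¹ ≤ C₂`. -/
theorem stmt17 (n : ℕ) (β : Fin n → ℝ) (hβpos : ∀ k, 0 < β k)
    (hβdist : Function.Injective β) :
    ∃ C₁ C₂ : ℝ, ∀ α : Fin n → ℂ,
      ∃ Λe : Finset ℤ,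
        (↑Λe ⊆ {j : ℤ | ∃ k, 1 ≤ ((2:ℝ) ^ j) ^ β k * ‖α k‖}) ∧
        (Λe.card : ℝ) ≤ C₁ ∧
        (∀ j : ℤ, (∃ k, 1 ≤ ((2:ℝ) ^ j) ^ β k * ‖α k‖) → j ∉ Λe →
          2/3 ≤ ‖∑ k, Complex.ofReal (((2:ℝ) ^ j) ^ β k) * α k‖) ∧
        (∑' j : ℤ, (if (∃ k, 1 ≤ ((2:ℝ) ^ j) ^ β k * ‖α k‖) ∧ j ∉ Λe
            then ‖∑ k, Complex.ofReal (((2:ℝ) ^ j) ^ β k) * α k‖⁻¹ else 0)) ≤ C₂ := by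
  simp only [zpow_rpow_comm (zero_le_two : (0 : ℝ) ≤ 2)]
  have hb (k) : (1 : ℝ) < 2 ^ β k := Real.one_lt_rpow one_lt_two (hβpos k)
  have hb0 (k) : (0 : ℝ) < 2 ^ β k := zero_lt_one.trans (hb k)
  have hbinj (k l) (h : k ≠ l) : (2 : ℝ) ^ β k ≠ 2 ^ β l := fun h' =>
    h (hβdist ((Real.strictMono_rpow_of_base_gt_one one_lt_two).injective h'))
  have hM : (0 : ℝ) ≤ 3 * n := by positivity
  have hN : ∀ k l, ∃ N : ℕ, k ≠ l → ∀ A B : ℝ, 0 < A → 0 < B → ∃ j₀ : ℤ, ∀ j : ℤ,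
      (2 ^ β k) ^ j * A ≤ 3 * n * ((2 ^ β l) ^ j * B) →
      (2 ^ β l) ^ j * B ≤ 3 * n * ((2 ^ β k) ^ j * A) →
      j ∈ Finset.Icc (j₀ - N) (j₀ + N) := by
    intro k l
    by_cases h : k = l
    · exact ⟨0, fun h' => (h' h).elim⟩
    · obtain ⟨N, hN⟩ := exists_Icc_of_zpow_comparable (hb0 k) (hb0 l) (hbinj k l h) hM
      exact ⟨N, fun _ => hN⟩
  choose N hN using hN
  refine ⟨((∑ p : Fin n × Fin n, (2 * N p.1 p.2 + 1) : ℕ) : ℝ),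
    3 / 2 * ∑ k, (1 - (2 ^ β k : ℝ)⁻¹)⁻¹, fun α => ?_⟩
  have hj : ∀ k l, ∃ j₀ : ℤ, k ≠ l → α k ≠ 0 → α l ≠ 0 → ∀ j : ℤ,
      (2 ^ β k) ^ j * ‖α k‖ ≤ 3 * n * ((2 ^ β l) ^ j * ‖α l‖) →
      (2 ^ β l) ^ j * ‖α l‖ ≤ 3 * n * ((2 ^ β k) ^ j * ‖α k‖) →
      j ∈ Finset.Icc (j₀ - N k l) (j₀ + N k l) := by
    intro k l
    by_cases h : k ≠ l ∧ α k ≠ 0 ∧ α l ≠ 0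
    · obtain ⟨j₀, hj₀⟩ := hN k l h.1 _ _ (norm_pos_iff.2 h.2.1) (norm_pos_iff.2 h.2.2)
      exact ⟨j₀, fun _ _ _ => hj₀⟩
    · exact ⟨0, fun h₁ h₂ h₃ => (h ⟨h₁, h₂, h₃⟩).elim⟩
  choose J hJ using hj
  set E : Finset ℤ := Finset.univ.biUnion fun p : Fin n × Fin n =>
    Finset.Icc (J p.1 p.2 - N p.1 p.2) (J p.1 p.2 + N p.1 p.2)
  set Λe : Finset ℤ := E.filter fun j => ∃ k, 1 ≤ ((2 : ℝ) ^ β k) ^ j * ‖α k‖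
  have main : ∀ j : ℤ, (∃ k, 1 ≤ ((2 : ℝ) ^ β k) ^ j * ‖α k‖) → j ∉ Λe →
      ∃ m, 1 ≤ ((2 : ℝ) ^ β m) ^ j * ‖α m‖ ∧ 2 / 3 * (((2 : ℝ) ^ β m) ^ j * ‖α m‖) ≤
        ‖∑ k, Complex.ofReal (((2 : ℝ) ^ β k) ^ j) * α k‖ := by
    rintro j ⟨k₀, hk₀⟩ hjE
    have hn1 : (1 : ℝ) ≤ n := by exact_mod_cast k₀.pos
    obtain ⟨m, -, hm⟩ := Finset.exists_max_image Finset.univ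
      (fun k => ((2 : ℝ) ^ β k) ^ j * ‖α k‖) ⟨k₀, Finset.mem_univ _⟩
    have hm1 := hk₀.trans (hm k₀ (Finset.mem_univ _))
    have hnorm (k) : ‖Complex.ofReal (((2 : ℝ) ^ β k) ^ j) * α k‖ =
        ((2 : ℝ) ^ β k) ^ j * ‖α k‖ := by
      rw [norm_mul, Complex.norm_of_nonneg (zpow_pos (hb0 k) j).le]
    refine ⟨m, hm1, ?_⟩
    rw [← hnorm m]
    refine two_thirds_mul_norm_le_norm_sum
      (fun k => Complex.ofReal (((2 : ℝ) ^ β k) ^ j) * α k) m fun k hkm => ?_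
    simp only [hnorm]
    by_contra! hlt
    have hαm : α m ≠ 0 := fun h => by
      rw [h, norm_zero, mul_zero] at hm1
      linarith
    have hαk : α k ≠ 0 := fun h => by
      rw [h, norm_zero, mul_zero, mul_zero] at hlt
      linarith
    refine hjE (Finset.mem_filter.2 ⟨Finset.mem_biUnion.2 ⟨(k, m), Finset.mem_univ _, ?_⟩,
      k₀, hk₀⟩)
    refine hJ k m hkm hαk hαm j ?_ hlt.le
    have := hm k (Finset.mem_univ _)
    nlinarith
  refine ⟨Λe, fun j hj => (Finset.mem_filter.1 hj).2, ?_, fun j hj hjE => ?_, ?_⟩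
  · refine Nat.cast_le.2 ((Finset.card_filter_le _ _).trans
      (Finset.card_biUnion_le.trans (Finset.sum_le_sum fun p _ => ?_)))
    rw [Int.card_Icc]
    omega
  · obtain ⟨m, hm, hm'⟩ := main j hj hjE
    linarith
  · choose g hg hg0 hgle using fun k => exists_hasSum_ge_inv_zpow_mul (hb k) (norm_nonneg (α k))
    have hsum := (hasSum_sum fun k (_ : k ∈ Finset.univ) => hg k).mul_left (3 / 2)
    have hnn (j : ℤ) : 0 ≤ 3 / 2 * ∑ k, g k j :=
      mul_nonneg (by norm_num) (Finset.sum_nonneg fun k _ => hg0 k j)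
    refine tsum_le_of_sum_le' (by simpa using hsum.nonneg hnn) fun s => ?_
    refine le_trans (Finset.sum_le_sum fun j _ => ?_) (sum_le_hasSum s (fun j _ => hnn j) hsum)
    split_ifs with h
    · obtain ⟨m, hm, hm'⟩ := main j h.1 h.2
      calc _ ≤ (2 / 3 * (((2 : ℝ) ^ β m) ^ j * ‖α m‖))⁻¹ := inv_anti₀ (by linarith) hm'
        _ = 3 / 2 * (((2 : ℝ) ^ β m) ^ j * ‖α m‖)⁻¹ := by rw [mul_inv]; norm_num
        _ ≤ 3 / 2 * ∑ k, g k j := by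
          gcongr
          exact (hgle m j hm).trans
            (Finset.single_le_sum (fun k _ => hg0 k j) (Finset.mem_univ m))
    · exact hnn j
end

section
/- Let c, c₁, c₂ > 0, a > 0 and ϵ ≥ 0 be given. For every sufficiently large N ∈ ℕ there exist constants C > 0 and ε₀ > 0, depending only on c, c₁, c₂, a, ϵ and N, such that the following holds. Let b = b(y₁,y₂) be a C² function on ℝ × [−1,1] with |b(0,0)| ≥ a, ‖b(y₁,·)‖_{C²([−1,1])} ≤ c₁ for every y₁ ∈ ℝ, |b(y₁,y₂) − b(0,0)| ≤ ε₀ and c₂|y₂|^{3−j} ≤ |∂_{y₂}^j(b(y₁,y₂)·y₂³)| for j = 1,2 and all (y₁,y₂) ∈ ℝ × [−1,1]; let Q be a C² function on [−1,1] with ‖Q‖_{C²([−1,1])} ≤ c₁; let r₁, r₂ be measurable functions on ℝ with |r_i(y₁)| ≤ c(1 + |y₁|); and let A, B, T be real numbers with T ≥ C, max{|A|, |B|} ≥ C, |A| ≤ T³ and |B| ≤ T². Then ∫_{−T}^{T} ∫_ℝ (1 + |A − (B + Q(y₂/T))y₂ − b(y₁, y₂/T)·y₂³ + r₁(y₁)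 + (y₂/T)·r₂(y₁)|)^{−N} (1 + |y₁|)^{−N} |y₂|^{ϵ} dy₁ dy₂ ≤ C · (max{|A|^{1/3}, |B|^{1/2}})^{ϵ − 1/2}. -/
open MeasureTheory Set

theorem lintegral_inv_one_add_sq :
    ∫⁻ x : ℝ, ENNReal.ofReal ((1 + x ^ 2)⁻¹) = ENNReal.ofReal Real.pi := by
  rw [← integral_univ_inv_one_add_sq,
    ofReal_integral_eq_lintegral_ofReal integrable_inv_one_add_sq]
  exact Filter.Eventually.of_forall fun x => by positivity

theorem Convex.exists_hasDerivWithinAt_eq_slope {s : Set ℝ} (hs : Convex ℝ s) {f f' : ℝ → ℝ}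
    (hf : ∀ x ∈ s, HasDerivWithinAt f (f' x) s x) {x y : ℝ} (hx : x ∈ s) (hy : y ∈ s)
    (hxy : x < y) : ∃ z ∈ s, x < z ∧ z < y ∧ f y - f x = f' z * (y - x) := by
  have hsub : Icc x y ⊆ s := hs.ordConnected.out hx hy
  obtain ⟨z, hz, h⟩ := exists_hasDerivAt_eq_slope f f' hxy
    (fun u hu => ((hf u (hsub hu)).mono hsub).continuousWithinAt)
    (fun u hu => (hf u (hsub (Ioo_subset_Icc_self hu))).hasDerivAt
      (Filter.mem_of_superset (Icc_mem_nhds hu.1 hu.2) hsub))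
  refine ⟨z, hsub (Ioo_subset_Icc_self hz), hz.1, hz.2, ?_⟩
  rw [h, div_mul_cancel₀ _ (sub_pos.2 hxy).ne']

theorem Convex.injOn_of_hasDerivWithinAt_ne_zero {s : Set ℝ} (hs : Convex ℝ s) {f f' : ℝ → ℝ}
    (hf : ∀ x ∈ s, HasDerivWithinAt f (f' x) s x) (hf' : ∀ x ∈ s, f' x ≠ 0) : InjOn f s := by
  have key : ∀ x ∈ s, ∀ y ∈ s, x < y → f x ≠ f y := by
    intro x hx y hy hxy h
    obtain ⟨z, hz, -, -, h'⟩ := hs.exists_hasDerivWithinAt_eq_slope hf hx hy hxy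
    rw [h, sub_self, eq_comm, mul_eq_zero] at h'
    exact h'.elim (hf' z hz) (sub_pos.2 hxy).ne'
  intro x hx y hy h
  rcases lt_trichotomy x y with h' | h' | h'
  · exact (key x hx y hy h' h).elim
  · exact h'
  · exact (key y hy x hx h' h.symm).elim

theorem lintegral_inv_one_add_sq_comp_le {s : Set ℝ} (hs : MeasurableSet s) {f f' : ℝ → ℝ}
    (hf : ∀ x ∈ s, HasDerivWithinAt f (f' x) s x) (hinj : InjOn f s) {l : ℝ} (hl : 0 < l)
    (hf' : ∀ x ∈ s, l ≤ |f' x|) :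
    ∫⁻ x in s, ENNReal.ofReal ((1 + f x ^ 2)⁻¹) ≤ ENNReal.ofReal (Real.pi / l) := by
  rw [ENNReal.ofReal_div_of_pos hl, ENNReal.le_div_iff_mul_le (by simp [hl]) (by simp), mul_comm,
    ← lintegral_const_mul' _ _ ENNReal.ofReal_ne_top]
  calc _ ≤ ∫⁻ x in s, ENNReal.ofReal |f' x| * ENNReal.ofReal ((1 + f x ^ 2)⁻¹) :=
        setLIntegral_mono' hs fun x hx => by gcongr; exact hf' x hx
    _ = ∫⁻ x in f '' s, ENNReal.ofReal ((1 + x ^ 2)⁻¹) :=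
        (lintegral_image_eq_lintegral_abs_deriv_mul hs hf hinj
          fun x => ENNReal.ofReal ((1 + x ^ 2)⁻¹)).symm
    _ ≤ ∫⁻ x : ℝ, ENNReal.ofReal ((1 + x ^ 2)⁻¹) := setLIntegral_le_lintegral _ _
    _ = _ := lintegral_inv_one_add_sq

/-- Van der Corput estimate under a lower bound for the second derivative. -/
theorem lintegral_inv_one_add_sq_comp_le_of_deriv2 {s : Set ℝ} (hs : Convex ℝ s)
    (hsc : IsClosed s) {f f' f'' : ℝ → ℝ}
    (hf : ∀ x ∈ s, HasDerivWithinAt f (f' x) s x)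
    (hf' : ∀ x ∈ s, HasDerivWithinAt f' (f'' x) s x) {l : ℝ} (hl : 0 < l)
    (hf'' : ∀ x ∈ s, l ^ 2 ≤ |f'' x|) :
    ∫⁻ x in s, ENNReal.ofReal ((1 + f x ^ 2)⁻¹) ≤ ENNReal.ofReal ((2 + 2 * Real.pi) / l) := by
  have hne : ∀ x ∈ s, f'' x ≠ 0 := fun x hx h => by
    have := hf'' x hx
    rw [h, abs_zero] at this
    nlinarith
  have hcont : ContinuousOn f' s := fun x hx => (hf' x hx).continuousWithinAt
  have hsign := hasDerivWithinAt_forall_lt_or_forall_gt_of_forall_ne hs hf' hne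
  have hinj : ∀ E ⊆ s, (∀ x ∈ E, ∀ y ∈ E, 0 < f' x * f' y) → InjOn f E := by
    intro E hE hpos
    have key : ∀ x ∈ E, ∀ y ∈ E, x < y → f x ≠ f y := by
      intro x hx y hy hxy h
      obtain ⟨z, hz, hxz, hzy, h'⟩ :=
        hs.exists_hasDerivWithinAt_eq_slope hf (hE hx) (hE hy) hxy
      rw [h, sub_self, eq_comm, mul_eq_zero] at h'
      have hz0 : f' z = 0 := h'.resolve_right (sub_pos.2 hxy).ne'
      obtain ⟨u, hu, -, -, h1⟩ := hs.exists_hasDerivWithinAt_eq_slope hf' (hE hx) hz hxz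
      obtain ⟨v, hv, -, -, h2⟩ := hs.exists_hasDerivWithinAt_eq_slope hf' hz (hE hy) hzy
      rw [hz0] at h1 h2
      have huv : 0 < f'' u * f'' v := by
        rcases hsign with h | h
        · exact mul_pos_of_neg_of_neg (h u hu) (h v hv)
        · exact mul_pos (h u hu) (h v hv)
      have h3 := hpos x hx y hy
      have h4 : 0 < (f'' u * f'' v) * ((z - x) * (y - z)) :=
        mul_pos huv (mul_pos (sub_pos.2 hxz) (sub_pos.2 hzy))
      have h5 : f' x * f' y = -((f'' u * f'' v) * ((z - x) * (y - z))) := by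
        have e1 : f' x = -(f'' u * (z - x)) := by linarith
        have e2 : f' y = f'' v * (y - z) := by linarith
        rw [e1, e2]; ring
      linarith
    intro x hx y hy h
    rcases lt_trichotomy x y with h' | h' | h'
    · exact (key x hx y hy h' h).elim
    · exact h'
    · exact (key y hy x hx h' h.symm).elim
  have hp := lintegral_inv_one_add_sq_comp_le (s := s ∩ f' ⁻¹' Ici l) (f := f) (f' := f')
    (hcont.preimage_isClosed_of_isClosed hsc isClosed_Ici).measurableSet
    (fun x hx => (hf x hx.1).mono inter_subset_left)
    (hinj _ inter_subset_left fun x hx y hy => mul_pos (hl.trans_le hx.2) (hl.trans_le hy.2)) hl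
    (fun x hx => le_trans hx.2 (le_abs_self _))
  have hn := lintegral_inv_one_add_sq_comp_le (s := s ∩ f' ⁻¹' Iic (-l)) (f := f) (f' := f')
    (hcont.preimage_isClosed_of_isClosed hsc isClosed_Iic).measurableSet
    (fun x hx => (hf x hx.1).mono inter_subset_left)
    (hinj _ inter_subset_left fun x hx y hy => mul_pos_of_neg_of_neg
      (lt_of_le_of_lt hx.2 (neg_neg_of_pos hl)) (lt_of_le_of_lt hy.2 (neg_neg_of_pos hl))) hl
    (fun x hx => le_trans (le_neg.1 hx.2) (neg_le_abs _))
  have hdist : ∀ x ∈ s, ∀ y ∈ s, x < y → |f' x| ≤ l → |f' y| ≤ l → y - x ≤ 2 / l := by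
    intro x hx y hy hxy h1 h2
    obtain ⟨z, hz, -, -, h⟩ := hs.exists_hasDerivWithinAt_eq_slope hf' hx hy hxy
    have h3 : |f' y - f' x| ≤ 2 * l := (abs_sub _ _).trans (by linarith)
    rw [h, abs_mul, abs_of_pos (sub_pos.2 hxy)] at h3
    rw [le_div_iff₀ hl]
    have h4 := mul_le_mul_of_nonneg_right (hf'' z hz) (sub_pos.2 hxy).le
    have h5 : l * ((y - x) * l) ≤ l * 2 := by linarith
    exact le_of_mul_le_mul_left h5 hl
  have hm : ∫⁻ x in s ∩ {x | |f' x| ≤ l}, ENNReal.ofReal ((1 + f x ^ 2)⁻¹)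
      ≤ ENNReal.ofReal (2 / l) := by
    calc _ ≤ ∫⁻ x in s ∩ {x | |f' x| ≤ l}, 1 := by
          refine lintegral_mono fun x => ?_
          rw [← ENNReal.ofReal_one]
          exact ENNReal.ofReal_le_ofReal (inv_le_one_of_one_le₀ (by nlinarith [sq_nonneg (f x)]))
      _ = volume (s ∩ {x | |f' x| ≤ l}) := by simp
      _ ≤ _ := (Real.volume_le_diam _).trans <| Metric.ediam_le fun x hx y hy => by
          rw [edist_dist, Real.dist_eq]
          apply ENNReal.ofReal_le_ofReal
          rcases lt_trichotomy x y with h | h | h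
          · rw [abs_sub_comm, abs_of_pos (sub_pos.2 h)]
            exact hdist x hx.1 y hy.1 h hx.2 hy.2
          · rw [h, sub_self, abs_zero]; positivity
          · rw [abs_of_pos (sub_pos.2 h)]
            exact hdist y hy.1 x hx.1 h hy.2 hx.2
  have hcov : s ⊆ (s ∩ {x | |f' x| ≤ l}) ∪ ((s ∩ f' ⁻¹' Ici l) ∪ (s ∩ f' ⁻¹' Iic (-l))) := by
    intro x hx
    rcases le_total |f' x| l with h | h
    · exact Or.inl ⟨hx, h⟩
    · rcases le_abs.1 h with h | h
      · exact Or.inr (Or.inl ⟨hx, h⟩)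
      · exact Or.inr (Or.inr ⟨hx, le_neg.1 h⟩)
  calc _ ≤ _ := lintegral_mono_set hcov
    _ ≤ _ := (lintegral_union_le _ _ _).trans (add_le_add le_rfl (lintegral_union_le _ _ _))
    _ ≤ _ := add_le_add hm (add_le_add hp hn)
    _ = _ := by
      rw [← ENNReal.ofReal_add (by positivity) (by positivity),
        ← ENNReal.ofReal_add (by positivity) (by positivity)]
      congr 1; ring

theorem inv_one_add_abs_pow_le {K : ℕ} (hK : 2 ≤ K) (x : ℝ) :
    ((1 + |x|) ^ K)⁻¹ ≤ (1 + x ^ 2)⁻¹ := by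
  have h : (1 + |x|) ^ 2 ≤ (1 + |x|) ^ K := pow_le_pow_right₀ (by simp) hK
  apply inv_anti₀ (by positivity)
  nlinarith [abs_nonneg x, sq_abs x]

theorem setLIntegral_weight_le {K : ℕ} (hK : 2 ≤ K) {ϵ R I : ℝ} (hϵ : 0 ≤ ϵ) (hR : 0 ≤ R)
    {s : Set ℝ} (hs : MeasurableSet s) {f : ℝ → ℝ} (hsR : ∀ y ∈ s, |y| ≤ R)
    (hI : ∫⁻ y in s, ENNReal.ofReal ((1 + f y ^ 2)⁻¹) ≤ ENNReal.ofReal I) :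
    ∫⁻ y in s, ENNReal.ofReal (((1 + |f y|) ^ K)⁻¹ * |y| ^ ϵ) ≤ ENNReal.ofReal (R ^ ϵ * I) := by
  rw [ENNReal.ofReal_mul (by positivity)]
  calc _ ≤ ∫⁻ y in s, ENNReal.ofReal (R ^ ϵ) * ENNReal.ofReal ((1 + f y ^ 2)⁻¹) := by
        refine setLIntegral_mono' hs fun y hy => ?_
        rw [← ENNReal.ofReal_mul (by positivity), mul_comm]
        apply ENNReal.ofReal_le_ofReal
        exact mul_le_mul (Real.rpow_le_rpow (abs_nonneg _) (hsR y hy) hϵ)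
          (inv_one_add_abs_pow_le hK _) (by positivity) (by positivity)
    _ = _ := lintegral_const_mul' _ _ ENNReal.ofReal_ne_top
    _ ≤ _ := by gcongr

theorem setLIntegral_le_of_le_inv_one_add_sq {s : Set ℝ} (hs : MeasurableSet s) {w : ℝ → ℝ}
    {k : ℝ} (hk : 0 ≤ k) (h : ∀ y ∈ s, w y ≤ k * (1 + y ^ 2)⁻¹) :
    ∫⁻ y in s, ENNReal.ofReal (w y) ≤ ENNReal.ofReal (k * Real.pi) := by
  rw [ENNReal.ofReal_mul hk, ← lintegral_inv_one_add_sq,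
    ← lintegral_const_mul' _ _ ENNReal.ofReal_ne_top]
  refine (setLIntegral_mono' hs fun y hy => ?_).trans (setLIntegral_le_lintegral _ _)
  rw [← ENNReal.ofReal_mul hk]
  exact ENNReal.ofReal_le_ofReal (h y hy)

theorem far_weight_le {K : ℕ} (hK : 2 ≤ K) {ϵ κ M x y : ℝ} (hϵ : 0 ≤ ϵ) (hϵK : ϵ ≤ K)
    (hκ : 0 < κ) (hM : 1 ≤ M) (hy : M ≤ |y|) (hx : κ * |y| ^ 3 ≤ |x|) :
    ((1 + |x|) ^ K)⁻¹ * |y| ^ ϵ ≤ 2 * (κ ^ K)⁻¹ * (M ^ ϵ / √M) * (1 + y ^ 2)⁻¹ := by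
  have hY : 1 ≤ |y| := hM.trans hy
  have h1 : (1 + |x|) ^ K ≥ (κ * |y| ^ 3) ^ K :=
    pow_le_pow_left₀ (by positivity) (by linarith) _
  have hMϵ : 1 ≤ M ^ ϵ := Real.one_le_rpow hM hϵ
  have hs : √M ≤ |y| := (Real.sqrt_le_self_iff.2 (Or.inr hM)).trans hy
  have hs0 : 0 < √M := Real.sqrt_pos.2 (by linarith)
  have hyϵ : |y| ^ ϵ ≤ |y| ^ K := by
    rw [← Real.rpow_natCast]; exact Real.rpow_le_rpow_of_exponent_le hY hϵK
  have hy2 : 1 + y ^ 2 ≤ 2 * |y| ^ 2 := by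
    rw [← sq_abs]; nlinarith
  have h2 : |y| ^ ϵ * (√M * (1 + y ^ 2)) ≤ 2 * |y| ^ (3 * K) * M ^ ϵ := by
    calc |y| ^ ϵ * (√M * (1 + y ^ 2)) ≤ |y| ^ K * (|y| * (2 * |y| ^ 2)) := by gcongr
      _ = 2 * |y| ^ (K + 3) := by ring
      _ ≤ 2 * |y| ^ (3 * K) := by gcongr; omega
      _ ≤ 2 * |y| ^ (3 * K) * M ^ ϵ := le_mul_of_one_le_right (by positivity) hMϵ
  calc ((1 + |x|) ^ K)⁻¹ * |y| ^ ϵ ≤ ((κ * |y| ^ 3) ^ K)⁻¹ * |y| ^ ϵ := by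
        gcongr
    _ = (κ ^ K)⁻¹ * (|y| ^ ϵ / |y| ^ (3 * K)) := by
        rw [mul_pow, ← pow_mul, mul_inv]; ring
    _ ≤ (κ ^ K)⁻¹ * (2 * M ^ ϵ / (√M * (1 + y ^ 2))) := by
        gcongr ?_ * ?_
        rw [div_le_div_iff₀ (by positivity) (by positivity)]
        linarith
    _ = _ := by field_simp

theorem near_weight_le {K : ℕ} (hK : 2 ≤ K) {ϵ M x y : ℝ} (hϵ : 0 ≤ ϵ)
    (hM : 1 ≤ M) (hy : |y| ≤ M) (hx : M ^ 3 / 2 ≤ |x|) :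
    ((1 + |x|) ^ K)⁻¹ * |y| ^ ϵ ≤ 8 * (M ^ ϵ / √M) * (1 + y ^ 2)⁻¹ := by
  have hs : √M ≤ M := Real.sqrt_le_self_iff.2 (Or.inr hM)
  have hs0 : 0 < √M := Real.sqrt_pos.2 (by linarith)
  have hM3 : 0 < M ^ 3 := by positivity
  have h1 : (M ^ 3 / 2) ^ 2 ≤ 1 + x ^ 2 := by
    rw [← sq_abs x]; nlinarith [pow_le_pow_left₀ (by positivity) hx 2]
  have hy2 : 1 + y ^ 2 ≤ 2 * M ^ 2 := by
    rw [← sq_abs]; nlinarith [abs_nonneg y]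
  have h2 : 4 * (√M * (1 + y ^ 2)) ≤ 8 * M ^ 6 := by
    calc 4 * (√M * (1 + y ^ 2)) ≤ 4 * (M * (2 * M ^ 2)) := by gcongr
      _ = 8 * M ^ 3 := by ring
      _ ≤ _ := by gcongr; norm_num
  calc ((1 + |x|) ^ K)⁻¹ * |y| ^ ϵ ≤ ((M ^ 3 / 2) ^ 2)⁻¹ * M ^ ϵ := by
        gcongr ?_ * ?_
        · exact (inv_one_add_abs_pow_le hK x).trans (inv_anti₀ (by positivity) h1)
        · exact Real.rpow_le_rpow (abs_nonneg _) hy hϵ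
    _ = M ^ ϵ * (4 / M ^ 6) := by field_simp; norm_num
    _ ≤ M ^ ϵ * (8 / (√M * (1 + y ^ 2))) := by
        gcongr ?_ * ?_
        rw [div_le_div_iff₀ (by positivity) (by positivity)]
        linarith
    _ = _ := by field_simp

set_option maxHeartbeats 1000000 in
/-- Uniform estimate for perturbations of `A - B y - b y³`, with `M` playing the role of
`max (|A|^{1/3}) (|B|^{1/2})`. -/
theorem exists_setLIntegral_perturbed_cubic_le {c₁ c₂ a ϵ : ℝ} (hc₁ : 0 < c₁) (hc₂ : 0 < c₂)
    (ha : 0 < a) (hϵ : 0 ≤ ϵ) {K : ℕ} (hK : 2 ≤ K) (hϵK : ϵ ≤ K) :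
    ∃ C : ℝ, 0 < C ∧ ∃ M₀ : ℝ, 1 ≤ M₀ ∧ ∀ (J : Set ℝ) (A B M : ℝ) (g g' g'' : ℝ → ℝ),
      Convex ℝ J → IsClosed J → M₀ ≤ M → |A| ≤ M ^ 3 → |B| ≤ M ^ 2 →
      (|A| = M ^ 3 ∨ |B| = M ^ 2) →
      (∀ y ∈ J, HasDerivWithinAt g (g' y) J y) →
      (∀ y ∈ J, HasDerivWithinAt g' (g'' y) J y) →
      (∀ y ∈ J, |A - B * y - g y| ≤ c₁ * (|y| + |y| ^ 3)) →
      (∀ y ∈ J, a * |y| ^ 3 - c₁ * |y| ≤ |A - B * y - g y|) →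
      (∀ y ∈ J, |g' y + B| ≤ c₁ * (2 + 4 * |y| ^ 2)) →
      (∀ y ∈ J, c₂ * |y| - 3 * c₁ ≤ |g'' y|) →
      ∫⁻ y in J, ENNReal.ofReal (((1 + |g y|) ^ K)⁻¹ * |y| ^ ϵ)
        ≤ ENNReal.ofReal (C * (M ^ ϵ / √M)) := by
  obtain ⟨δ, hδ⟩ : ∃ δ, δ = 1 / (32 * (1 + c₁)) := ⟨_, rfl⟩
  obtain ⟨L, hL⟩ : ∃ L, L = 1 + 2 * (2 + c₁) / a := ⟨_, rfl⟩
  have hδ0 : 0 < δ := by rw [hδ]; positivity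
  have hδ1 : δ * (1 + c₁) = 1 / 32 := by rw [hδ]; field_simp
  have hδ2 : δ ≤ 1 / 32 := by nlinarith
  have hδc : c₁ * δ ≤ 1 / 32 := by linarith
  have hL1 : 1 ≤ L := by rw [hL]; simp; positivity
  have hLa : 2 + c₁ ≤ a / 2 * L := by
    have : a / 2 * L = a / 2 + (2 + c₁) := by rw [hL]; field_simp
    linarith
  obtain ⟨l, hl⟩ : ∃ l, l = √(c₂ * δ / 2) := ⟨_, rfl⟩
  have hl0 : 0 < l := by rw [hl]; exact Real.sqrt_pos.2 (by positivity)
  have hl2 : l ^ 2 = c₂ * δ / 2 := by rw [hl]; exact Real.sq_sqrt (by positivity)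
  refine ⟨8 * Real.pi + (L ^ ϵ * ((2 + 2 * Real.pi) / l) + (L ^ ϵ * ((2 + 2 * Real.pi) / l)
    + 2 * ((a / 2) ^ K)⁻¹ * Real.pi)), by positivity, 1 + 16 * c₁ + 6 * c₁ / (c₂ * δ),
    by linarith [show 0 < 6 * c₁ / (c₂ * δ) by positivity], ?_⟩
  intro J A B M g g' g'' hJ hJc hM₀ hA hB hAB hg hg' h0 h0' h1 h2
  have hpos : 0 < 6 * c₁ / (c₂ * δ) := by positivity
  have hM1 : 1 ≤ M := by linarith
  have hMc : 16 * c₁ ≤ M := by linarith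
  have hMδ : 6 * c₁ ≤ c₂ * δ * M := by
    have : 6 * c₁ / (c₂ * δ) ≤ M := by linarith
    rw [div_le_iff₀ (by positivity)] at this
    linarith
  have hM0 : 0 < M := by linarith
  have hs : √M ≤ M := Real.sqrt_le_self_iff.2 (Or.inr hM1)
  have hs0 : 0 < √M := Real.sqrt_pos.2 hM0
  have hM12 : M ≤ M ^ 2 := by nlinarith
  have hJm : MeasurableSet J := hJc.measurableSet
  have hδM : δ * M ≤ M := by nlinarith
  have hsmall : ∫⁻ y in J ∩ Icc (-(δ * M)) (δ * M),
      ENNReal.ofReal (((1 + |g y|) ^ K)⁻¹ * |y| ^ ϵ)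
        ≤ ENNReal.ofReal (8 * Real.pi * (M ^ ϵ / √M)) := by
    have hm : MeasurableSet (J ∩ Icc (-(δ * M)) (δ * M)) := hJm.inter measurableSet_Icc
    rcases le_or_gt (M ^ 2 / 2) |B| with hB' | hB'
    · have hlow : ∀ y ∈ J ∩ Icc (-(δ * M)) (δ * M), M ^ 2 / 4 ≤ |g' y| := by
        intro y hy
        have hyM : |y| ≤ δ * M := abs_le.2 hy.2
        have e1 := h1 y hy.1
        have e2 : |y| ^ 2 ≤ δ * (δ * M ^ 2) := by
          calc |y| ^ 2 ≤ (δ * M) ^ 2 := by gcongr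
            _ = _ := by ring
        have e3 : c₁ * |y| ^ 2 ≤ M ^ 2 / 32 := by
          calc c₁ * |y| ^ 2 ≤ c₁ * (δ * (δ * M ^ 2)) := by gcongr
            _ = (c₁ * δ) * (δ * M ^ 2) := by ring
            _ ≤ 1 / 32 * (1 * M ^ 2) := by gcongr; linarith
            _ = _ := by ring
        have e4 : |B| ≤ |g' y + B| + |g' y| := by
          calc |B| = |(g' y + B) - g' y| := by congr 1; ring
            _ ≤ _ := abs_sub _ _
        linarith
      have hne : ∀ y ∈ J ∩ Icc (-(δ * M)) (δ * M), g' y ≠ 0 := fun y hy h => by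
        have := hlow y hy
        rw [h, abs_zero] at this
        nlinarith
      have hder : ∀ y ∈ J ∩ Icc (-(δ * M)) (δ * M),
          HasDerivWithinAt g (g' y) (J ∩ Icc (-(δ * M)) (δ * M)) y :=
        fun y hy => (hg y hy.1).mono inter_subset_left
      refine (setLIntegral_weight_le hK hϵ hM0.le hm
        (fun y hy => (abs_le.2 hy.2).trans hδM)
        (lintegral_inv_one_add_sq_comp_le hm hder
          ((hJ.inter (convex_Icc _ _)).injOn_of_hasDerivWithinAt_ne_zero hder hne)
          (l := M ^ 2 / 4) (by positivity) hlow)).trans (ENNReal.ofReal_le_ofReal ?_)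
      calc M ^ ϵ * (Real.pi / (M ^ 2 / 4)) = 4 * Real.pi * (M ^ ϵ / M ^ 2) := by field_simp
        _ ≤ 8 * Real.pi * (M ^ ϵ / √M) := by gcongr <;> linarith
    · have hA' : |A| = M ^ 3 := hAB.resolve_right (by nlinarith)
      refine (setLIntegral_le_of_le_inv_one_add_sq hm (k := 8 * (M ^ ϵ / √M)) (by positivity)
        fun y hy => near_weight_le hK hϵ hM1 ((abs_le.2 hy.2).trans hδM) ?_).trans_eq
        (by congr 1; ring)
      have hyM : |y| ≤ δ * M := abs_le.2 hy.2
      have e0 := h0 y hy.1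
      have e1 : |B * y| ≤ M ^ 3 / 64 := by
        rw [abs_mul]
        calc |B| * |y| ≤ M ^ 2 / 2 * (δ * M) := by gcongr
          _ = M ^ 3 / 2 * δ := by ring
          _ ≤ M ^ 3 / 2 * (1 / 32) := by gcongr
          _ = _ := by ring
      have e2 : c₁ * |y| ≤ M ^ 3 / 32 := by
        calc c₁ * |y| ≤ c₁ * (δ * M) := by gcongr
          _ = c₁ * δ * M := by ring
          _ ≤ 1 / 32 * M ^ 3 := by gcongr; exact le_self_pow₀ hM1 (by norm_num)
          _ = _ := by ring
      have e3 : c₁ * |y| ^ 3 ≤ M ^ 3 / 32 := by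
        calc c₁ * |y| ^ 3 ≤ c₁ * (δ * M) ^ 3 := by gcongr
          _ = c₁ * δ * (δ * δ * M ^ 3) := by ring
          _ ≤ 1 / 32 * (1 * 1 * M ^ 3) := by gcongr <;> linarith
          _ = _ := by ring
      have e4 : |A| ≤ |A - B * y - g y| + |B * y| + |g y| := by
        calc |A| = |(A - B * y - g y) + B * y + g y| := by congr 1; ring
          _ ≤ _ := abs_add_three _ _ _
      linarith [pow_pos hM0 3]
  have hmid : ∀ S : Set ℝ, Convex ℝ S → IsClosed S →
      (∀ y ∈ S, δ * M ≤ |y|) → (∀ y ∈ S, |y| ≤ L * M) →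
      ∫⁻ y in J ∩ S, ENNReal.ofReal (((1 + |g y|) ^ K)⁻¹ * |y| ^ ϵ)
        ≤ ENNReal.ofReal (L ^ ϵ * ((2 + 2 * Real.pi) / l) * (M ^ ϵ / √M)) := by
    intro S hS hSc hlo hhi
    have hlow : ∀ y ∈ J ∩ S, (l * √M) ^ 2 ≤ |g'' y| := by
      intro y hy
      rw [mul_pow, hl2, Real.sq_sqrt hM0.le]
      have e1 := h2 y hy.1
      have e2 := mul_le_mul_of_nonneg_left (hlo y hy.2) hc₂.le
      linarith
    refine (setLIntegral_weight_le hK hϵ (by positivity) (hJm.inter hSc.measurableSet)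
      (fun y hy => hhi y hy.2) (lintegral_inv_one_add_sq_comp_le_of_deriv2 (hJ.inter hS)
        (hJc.inter hSc) (fun y hy => (hg y hy.1).mono inter_subset_left)
        (fun y hy => (hg' y hy.1).mono inter_subset_left) (l := l * √M) (by positivity)
        hlow)).trans_eq ?_
    rw [Real.mul_rpow (by positivity) hM0.le]
    congr 1
    field_simp
  have hlarge : ∫⁻ y in J ∩ {y | L * M ≤ |y|}, ENNReal.ofReal (((1 + |g y|) ^ K)⁻¹ * |y| ^ ϵ)
      ≤ ENNReal.ofReal (2 * ((a / 2) ^ K)⁻¹ * Real.pi * (M ^ ϵ / √M)) := by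
    refine (setLIntegral_le_of_le_inv_one_add_sq
      (hJm.inter (isClosed_le continuous_const continuous_abs).measurableSet)
      (k := 2 * ((a / 2) ^ K)⁻¹ * (M ^ ϵ / √M)) (by positivity)
      fun y hy => ?_).trans_eq (by congr 1; ring)
    have hyL : L * M ≤ |y| := hy.2
    have hyM : M ≤ |y| := (le_mul_of_one_le_left hM0.le hL1).trans hyL
    refine far_weight_le hK hϵ hϵK (by positivity) hM1 hyM ?_
    have e0 := h0' y hy.1
    have hY0 : 0 < |y| := by linarith
    have e1 : M ^ 3 ≤ M * |y| ^ 2 := by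
      calc M ^ 3 = M * M ^ 2 := by ring
        _ ≤ _ := by gcongr
    have e2 : |B * y| ≤ M * |y| ^ 2 := by
      rw [abs_mul]
      calc |B| * |y| ≤ M ^ 2 * |y| := by gcongr
        _ = M * (M * |y|) := by ring
        _ ≤ M * (|y| * |y|) := by gcongr
        _ = _ := by ring
    have e3 : c₁ * |y| ≤ c₁ * (M * |y| ^ 2) := by
      gcongr
      nlinarith
    have e5 : (2 + c₁) * (M * |y| ^ 2) ≤ a / 2 * |y| ^ 3 := by
      calc (2 + c₁) * (M * |y| ^ 2) ≤ a / 2 * L * (M * |y| ^ 2) := by gcongr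
        _ = a / 2 * ((L * M) * |y| ^ 2) := by ring
        _ ≤ a / 2 * (|y| * |y| ^ 2) := by gcongr
        _ = _ := by ring
    have e4 : |A - B * y - g y| ≤ |A| + |B * y| + |g y| :=
      (abs_sub _ _).trans (by gcongr; exact abs_sub _ _)
    linarith
  have hcov : J ⊆ (J ∩ Icc (-(δ * M)) (δ * M)) ∪ ((J ∩ Icc (δ * M) (L * M)) ∪
      ((J ∩ Icc (-(L * M)) (-(δ * M))) ∪ (J ∩ {y | L * M ≤ |y|}))) := by
    intro y hy
    rcases le_or_gt |y| (δ * M) with h | h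
    · exact Or.inl ⟨hy, abs_le.1 h⟩
    rcases le_or_gt (L * M) |y| with h' | h'
    · exact Or.inr (Or.inr (Or.inr ⟨hy, h'⟩))
    obtain ⟨h3, h4⟩ := abs_lt.1 h'
    rcases lt_abs.1 h with h | h
    · exact Or.inr (Or.inl ⟨hy, h.le, h4.le⟩)
    · exact Or.inr (Or.inr (Or.inl ⟨hy, h3.le, by linarith⟩))
  have hδM0 : 0 < δ * M := by positivity
  have hright := hmid (Icc (δ * M) (L * M)) (convex_Icc _ _) isClosed_Icc
    (fun y hy => hy.1.trans (le_abs_self y))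
    (fun y hy => abs_le.2 ⟨by linarith [hy.1, hy.2], hy.2⟩)
  have hleft := hmid (Icc (-(L * M)) (-(δ * M))) (convex_Icc _ _) isClosed_Icc
    (fun y hy => (le_neg.1 hy.2).trans (neg_le_abs y))
    (fun y hy => abs_le.2 ⟨hy.1, by linarith [hy.1, hy.2]⟩)
  calc _ ≤ _ := lintegral_mono_set hcov
    _ ≤ _ := (lintegral_union_le _ _ _).trans (add_le_add le_rfl
      ((lintegral_union_le _ _ _).trans (add_le_add le_rfl (lintegral_union_le _ _ _))))
    _ ≤ _ := add_le_add hsmall (add_le_add hright (add_le_add hleft hlarge))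
    _ = _ := by
      rw [← ENNReal.ofReal_add (by positivity) (by positivity),
        ← ENNReal.ofReal_add (by positivity) (by positivity),
        ← ENNReal.ofReal_add (by positivity) (by positivity)]
      congr 1; ring

theorem ContDiffOn.hasDerivWithinAt_iteratedDerivWithin {f : ℝ → ℝ} {s : Set ℝ} {n : ℕ}
    (hf : ContDiffOn ℝ n f s) (hs : UniqueDiffOn ℝ s) {i : ℕ} (hi : i < n) {x : ℝ} (hx : x ∈ s) :
    HasDerivWithinAt (iteratedDerivWithin i f s) (iteratedDerivWithin (i + 1) f s x) s x := by
  rw [iteratedDerivWithin_succ]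
  exact (hf.differentiableOn_iteratedDerivWithin (by exact_mod_cast hi) hs x hx).hasDerivWithinAt

theorem div_mem_Icc_neg_one_one {T y : ℝ} (hT : 0 < T) (hy : y ∈ Icc (-T) T) :
    y / T ∈ Icc (-1 : ℝ) 1 := by
  constructor
  · rw [le_div_iff₀ hT]; linarith [hy.1]
  · rw [div_le_iff₀ hT]; linarith [hy.2]

theorem HasDerivWithinAt.comp_div_Icc {f : ℝ → ℝ} {d T y : ℝ} (hT : 0 < T)
    (hf : HasDerivWithinAt f d (Icc (-1 : ℝ) 1) (y / T)) :
    HasDerivWithinAt (fun z => f (z / T)) (d / T) (Icc (-T) T) y := by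
  have h := hf.comp y ((hasDerivWithinAt_id y (Icc (-T) T)).div_const T)
    (fun z hz => div_mem_Icc_neg_one_one hT hz)
  rw [div_eq_mul_one_div]
  exact h

/-- The estimate for the unperturbed phase with the first variable frozen. -/
theorem exists_setLIntegral_phase_le {c₁ c₂ a ϵ : ℝ} (hc₁ : 0 < c₁) (hc₂ : 0 < c₂)
    (ha : 0 < a) (hϵ : 0 ≤ ϵ) {K : ℕ} (hK : 2 ≤ K) (hϵK : ϵ ≤ K) :
    ∃ C : ℝ, 0 < C ∧ ∃ M₀ : ℝ, 1 ≤ M₀ ∧ ∀ (b Q : ℝ → ℝ) (A B T M : ℝ),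
      1 ≤ T → M₀ ≤ M → |A| ≤ M ^ 3 → |B| ≤ M ^ 2 → (|A| = M ^ 3 ∨ |B| = M ^ 2) →
      ContDiffOn ℝ 2 b (Icc (-1:ℝ) 1) →
      (∀ i ≤ 2, ∀ t ∈ Icc (-1:ℝ) 1, |iteratedDerivWithin i b (Icc (-1:ℝ) 1) t| ≤ c₁) →
      (∀ t ∈ Icc (-1:ℝ) 1, a ≤ |b t|) →
      (∀ t ∈ Icc (-1:ℝ) 1, c₂ * |t| ≤
        |iteratedDerivWithin 2 (fun t => b t * t ^ 3) (Icc (-1:ℝ) 1) t|) →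
      ContDiffOn ℝ 2 Q (Icc (-1:ℝ) 1) →
      (∀ i ≤ 2, ∀ t ∈ Icc (-1:ℝ) 1, |iteratedDerivWithin i Q (Icc (-1:ℝ) 1) t| ≤ c₁) →
      ∫⁻ y in Icc (-T) T, ENNReal.ofReal
        (((1 + |A - (B + Q (y / T)) * y - b (y / T) * y ^ 3|) ^ K)⁻¹ * |y| ^ ϵ)
        ≤ ENNReal.ofReal (C * (M ^ ϵ / √M)) := by
  obtain ⟨C, hC, M₀, hM₀, H⟩ :=
    exists_setLIntegral_perturbed_cubic_le hc₁ hc₂ ha hϵ hK hϵK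
  refine ⟨C, hC, M₀, hM₀, fun b Q A B T M hT hM hA hB hAB hb hbc hba hβ hQ hQc => ?_⟩
  have hT0 : 0 < T := by linarith
  have hu : UniqueDiffOn ℝ (Icc (-1:ℝ) 1) := uniqueDiffOn_Icc (by norm_num)
  obtain ⟨I, hI⟩ : ∃ I, I = Icc (-1:ℝ) 1 := ⟨_, rfl⟩
  rw [← hI] at hb hbc hba hβ hQ hQc hu
  obtain ⟨β, hβdef⟩ : ∃ β : ℝ → ℝ, β = fun t => b t * t ^ 3 := ⟨_, rfl⟩
  rw [← hβdef] at hβ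
  have hβC : ContDiffOn ℝ 2 β I := by
    rw [hβdef]; exact hb.mul (contDiff_id.pow 3).contDiffOn
  have hb0 : ∀ t ∈ I, HasDerivWithinAt b (iteratedDerivWithin 1 b I t) I t := fun t ht => by
    simpa using hb.hasDerivWithinAt_iteratedDerivWithin (n := 2) (i := 0) hu (by norm_num) ht
  have hQ0 : ∀ t ∈ I, HasDerivWithinAt Q (iteratedDerivWithin 1 Q I t) I t := fun t ht => by
    simpa using hQ.hasDerivWithinAt_iteratedDerivWithin (n := 2) (i := 0) hu (by norm_num) ht
  have hQ1 : ∀ t ∈ I, HasDerivWithinAt (iteratedDerivWithin 1 Q I)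
      (iteratedDerivWithin 2 Q I t) I t := fun t ht =>
    hQ.hasDerivWithinAt_iteratedDerivWithin (n := 2) (i := 1) hu (by norm_num) ht
  have hβ0 : ∀ t ∈ I, HasDerivWithinAt β (iteratedDerivWithin 1 β I t) I t := fun t ht => by
    simpa using hβC.hasDerivWithinAt_iteratedDerivWithin (n := 2) (i := 0) hu (by norm_num) ht
  have hβ1 : ∀ t ∈ I, HasDerivWithinAt (iteratedDerivWithin 1 β I)
      (iteratedDerivWithin 2 β I t) I t := fun t ht =>
    hβC.hasDerivWithinAt_iteratedDerivWithin (n := 2) (i := 1) hu (by norm_num) ht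
  have hq0 : ∀ t ∈ I, HasDerivWithinAt (fun t => Q t * t)
      (iteratedDerivWithin 1 Q I t * t + Q t) I t := fun t ht => by
    exact ((hQ0 t ht).mul (hasDerivWithinAt_id t I)).congr_deriv (by simp)
  have hq1 : ∀ t ∈ I, HasDerivWithinAt (fun t => iteratedDerivWithin 1 Q I t * t + Q t)
      (iteratedDerivWithin 2 Q I t * t + iteratedDerivWithin 1 Q I t
        + iteratedDerivWithin 1 Q I t) I t := fun t ht => by
    exact (((hQ1 t ht).mul (hasDerivWithinAt_id t I)).add (hQ0 t ht)).congr_deriv (by simp)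
  have hI1 : ∀ t ∈ I, |t| ≤ 1 := fun t ht => abs_le.2 (by rwa [hI] at ht)
  have hβ0' : ∀ t ∈ I, |iteratedDerivWithin 1 β I t| ≤ 4 * c₁ * |t| ^ 2 := by
    intro t ht
    have h1 : HasDerivWithinAt β (iteratedDerivWithin 1 b I t * t ^ 3 + b t * (3 * t ^ 2)) I t := by
      rw [hβdef]
      exact ((hb0 t ht).mul ((hasDerivWithinAt_id t I).pow 3)).congr_deriv (by simp)
    rw [(hu t ht).eq_deriv _ (hβ0 t ht) h1]
    have hb1 := hbc 1 (by norm_num) t ht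
    have hb2 := hbc 0 (by norm_num) t ht
    rw [iteratedDerivWithin_zero] at hb2
    have ht1 := hI1 t ht
    calc |iteratedDerivWithin 1 b I t * t ^ 3 + b t * (3 * t ^ 2)|
        ≤ |iteratedDerivWithin 1 b I t * t ^ 3| + |b t * (3 * t ^ 2)| := abs_add_le _ _
      _ = |iteratedDerivWithin 1 b I t| * (|t| * |t| ^ 2) + |b t| * (3 * |t| ^ 2) := by
        rw [abs_mul, abs_mul (b t), abs_mul 3, abs_pow, abs_pow, abs_of_pos (show (0:ℝ) < 3 by norm_num)]
        ring
      _ ≤ c₁ * (1 * |t| ^ 2) + c₁ * (3 * |t| ^ 2) := by gcongr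
      _ = _ := by ring
  have hmem : ∀ y ∈ Icc (-T) T, y / T ∈ I := fun y hy => by
    rw [hI]; exact div_mem_Icc_neg_one_one hT0 hy
  have hscale : ∀ {f : ℝ → ℝ} {d y : ℝ}, HasDerivWithinAt f d I (y / T) →
      HasDerivWithinAt (fun z => f (z / T)) (d / T) (Icc (-T) T) y := fun h => by
    rw [hI] at h; exact h.comp_div_Icc hT0
  refine H (Icc (-T) T) A B M _
    (fun y => -B - (iteratedDerivWithin 1 Q I (y / T) * (y / T) + Q (y / T))
      - T ^ 2 * iteratedDerivWithin 1 β I (y / T))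
    (fun y => -((iteratedDerivWithin 2 Q I (y / T) * (y / T) + iteratedDerivWithin 1 Q I (y / T)
        + iteratedDerivWithin 1 Q I (y / T)) / T)
      - T * iteratedDerivWithin 2 β I (y / T))
    (convex_Icc _ _) isClosed_Icc hM hA hB hAB ?_ ?_ ?_ ?_ ?_ ?_
  · intro y hy
    have h1 := (hscale (hq0 _ (hmem y hy))).const_mul T
    have h2 := (hscale (hβ0 _ (hmem y hy))).const_mul (T ^ 3)
    have h3 := ((hasDerivWithinAt_id y (Icc (-T) T)).const_mul B).const_sub A
    refine (((h3.sub h1).sub h2).congr_deriv ?_).congr_of_mem (fun z _ => ?_) hy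
    · field_simp
    · simp only [hβdef, Pi.sub_apply, id]
      field_simp
      ring
  · intro y hy
    have h1 := hscale (hq1 _ (hmem y hy))
    have h2 := (hscale (hβ1 _ (hmem y hy))).const_mul (T ^ 2)
    refine ((h1.const_sub (-B)).sub h2).congr_deriv ?_
    field_simp
  · intro y hy
    have hb2 := hbc 0 (by norm_num) _ (hmem y hy)
    have hQ2 := hQc 0 (by norm_num) _ (hmem y hy)
    rw [iteratedDerivWithin_zero] at hb2 hQ2
    calc |A - B * y - (A - (B + Q (y / T)) * y - b (y / T) * y ^ 3)|
        = |Q (y / T) * y + b (y / T) * y ^ 3| := by congr 1; ring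
      _ ≤ |Q (y / T) * y| + |b (y / T) * y ^ 3| := abs_add_le _ _
      _ = |Q (y / T)| * |y| + |b (y / T)| * |y| ^ 3 := by simp only [abs_mul, abs_pow]
      _ ≤ c₁ * |y| + c₁ * |y| ^ 3 := by gcongr
      _ = _ := by ring
  · intro y hy
    have hb2 := hba _ (hmem y hy)
    have hQ2 := hQc 0 (by norm_num) _ (hmem y hy)
    rw [iteratedDerivWithin_zero] at hQ2
    calc a * |y| ^ 3 - c₁ * |y| ≤ |b (y / T)| * |y| ^ 3 - |Q (y / T)| * |y| := by gcongr
      _ = |b (y / T) * y ^ 3| - |-(Q (y / T) * y)| := by simp only [abs_neg, abs_mul, abs_pow]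
      _ ≤ |b (y / T) * y ^ 3 - -(Q (y / T) * y)| := abs_sub_abs_le_abs_sub _ _
      _ = _ := by congr 1; ring
  · intro y hy
    have ht := hmem y hy
    have hQ2 := hQc 0 (by norm_num) _ ht
    rw [iteratedDerivWithin_zero] at hQ2
    have hQ3 := hQc 1 (by norm_num) _ ht
    have h1 := hβ0' _ ht
    have h2 : T ^ 2 * |y / T| ^ 2 = |y| ^ 2 := by
      rw [abs_div, abs_of_pos hT0]; field_simp
    have ht1 := hI1 _ ht
    calc |-B - (iteratedDerivWithin 1 Q I (y / T) * (y / T) + Q (y / T))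
          - T ^ 2 * iteratedDerivWithin 1 β I (y / T) + B|
        = |iteratedDerivWithin 1 Q I (y / T) * (y / T) + Q (y / T)
          + T ^ 2 * iteratedDerivWithin 1 β I (y / T)| := by rw [← abs_neg]; congr 1; ring
      _ ≤ |iteratedDerivWithin 1 Q I (y / T) * (y / T)| + |Q (y / T)|
          + |T ^ 2 * iteratedDerivWithin 1 β I (y / T)| := abs_add_three _ _ _
      _ = |iteratedDerivWithin 1 Q I (y / T)| * |y / T| + |Q (y / T)|
          + T ^ 2 * |iteratedDerivWithin 1 β I (y / T)| := by
        rw [abs_mul, abs_mul (T ^ 2), abs_of_pos (pow_pos hT0 2)]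
      _ ≤ c₁ * 1 + c₁ + T ^ 2 * (4 * c₁ * |y / T| ^ 2) := by gcongr
      _ = 2 * c₁ + 4 * c₁ * (T ^ 2 * |y / T| ^ 2) := by ring
      _ = _ := by rw [h2]; ring
  · intro y hy
    have ht := hmem y hy
    have hQ3 := hQc 1 (by norm_num) _ ht
    have hQ4 := hQc 2 le_rfl _ ht
    have h1 := mul_le_mul_of_nonneg_left (hβ _ ht) hT0.le
    have h2 : T * (c₂ * |y / T|) = c₂ * |y| := by
      rw [abs_div, abs_of_pos hT0]; field_simp
    have ht1 := hI1 _ ht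
    rw [h2] at h1
    set q2 := iteratedDerivWithin 2 Q I (y / T) * (y / T) + iteratedDerivWithin 1 Q I (y / T)
        + iteratedDerivWithin 1 Q I (y / T) with hq2
    have h3 : |q2 / T| ≤ 3 * c₁ := by
      rw [abs_div, abs_of_pos hT0]
      refine (div_le_self (abs_nonneg _) hT).trans ?_
      calc |q2| ≤ |iteratedDerivWithin 2 Q I (y / T) * (y / T)|
            + |iteratedDerivWithin 1 Q I (y / T)| + |iteratedDerivWithin 1 Q I (y / T)| :=
          abs_add_three _ _ _
        _ ≤ c₁ * 1 + c₁ + c₁ := by rw [abs_mul]; gcongr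
        _ = _ := by ring
    have h4 : |T * iteratedDerivWithin 2 β I (y / T)| - |q2 / T|
        ≤ |-(q2 / T) - T * iteratedDerivWithin 2 β I (y / T)| := by
      rw [abs_sub_comm (-(q2 / T)), sub_neg_eq_add, ← sub_neg_eq_add, ← abs_neg (q2 / T)]
      exact abs_sub_abs_le_abs_sub _ _
    rw [abs_mul, abs_of_pos hT0] at h4
    linarith

theorem perturbed_weight_le {K N : ℕ} (hN : K + 2 ≤ N) {c x r y : ℝ} (hc : 0 < c)
    (hr : |r| ≤ 2 * c * (1 + |y|)) :
    ((1 + |x + r|) ^ N)⁻¹ * ((1 + |y|) ^ N)⁻¹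
      ≤ (1 + 2 * c) ^ K * (1 + y ^ 2)⁻¹ * ((1 + |x|) ^ K)⁻¹ := by
  have hx : 1 + |x| ≤ (1 + 2 * c) * (1 + |x + r|) * (1 + |y|) := by
    have h1 : |x| ≤ |x + r| + |r| := by
      calc |x| = |(x + r) - r| := by congr 1; ring
        _ ≤ _ := abs_sub _ _
    have h2 : 0 ≤ |x + r| * |y| := by positivity
    have h3 : 0 ≤ c * |x + r| * (1 + |y|) := by positivity
    linarith [abs_nonneg y, abs_nonneg (x + r)]
  have hy : 1 + y ^ 2 ≤ (1 + |y|) ^ 2 := by nlinarith [abs_nonneg y, sq_abs y]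
  have key : (1 + |x|) ^ K * (1 + y ^ 2)
      ≤ (1 + 2 * c) ^ K * ((1 + |x + r|) ^ N * (1 + |y|) ^ N) := by
    calc (1 + |x|) ^ K * (1 + y ^ 2)
        ≤ ((1 + 2 * c) * (1 + |x + r|) * (1 + |y|)) ^ K * (1 + |y|) ^ 2 := by gcongr
      _ = (1 + 2 * c) ^ K * ((1 + |x + r|) ^ K * (1 + |y|) ^ (K + 2)) := by
        rw [mul_pow, mul_pow, pow_add]; ring
      _ ≤ _ := by
        gcongr
        · simp
        · omega
        · simp
  rw [← mul_inv, mul_assoc, ← mul_inv, ← div_eq_mul_inv, inv_eq_one_div,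
    div_le_div_iff₀ (by positivity) (by positivity)]
  linarith

theorem aemeasurable_phase_weight {b : ℝ → ℝ → ℝ} {Q : ℝ → ℝ} {A B T ϵ : ℝ} {K : ℕ} (hT : 0 < T)
    (hb : ContinuousOn (fun p : ℝ × ℝ => b p.1 p.2) (univ ×ˢ Icc (-1:ℝ) 1))
    (hQ : ContinuousOn Q (Icc (-1:ℝ) 1)) :
    AEMeasurable (fun p : ℝ × ℝ => ENNReal.ofReal
      (((1 + |A - (B + Q (p.1 / T)) * p.1 - b p.2 (p.1 / T) * p.1 ^ 3|) ^ K)⁻¹ * |p.1| ^ ϵ))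
      ((volume.restrict (Icc (-T) T)).prod volume) := by
  have hμ : (volume.restrict (Icc (-T) T)).prod (volume : Measure ℝ)
      = (volume.prod volume).restrict (Icc (-T) T ×ˢ (univ : Set ℝ)) := by
    rw [← Measure.prod_restrict, Measure.restrict_univ]
  have hb' : ContinuousOn (fun p : ℝ × ℝ => b p.2 (p.1 / T)) (Icc (-T) T ×ˢ (univ : Set ℝ)) :=
    hb.comp (f := fun p : ℝ × ℝ => (p.2, p.1 / T)) (by fun_prop)
      fun p hp => ⟨mem_univ _, div_mem_Icc_neg_one_one hT hp.1⟩
  have hQ' : ContinuousOn (fun p : ℝ × ℝ => Q (p.1 / T)) (Icc (-T) T ×ˢ (univ : Set ℝ)) :=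
    hQ.comp (f := fun p : ℝ × ℝ => p.1 / T) (by fun_prop)
      fun p hp => div_mem_Icc_neg_one_one hT hp.1
  have hg : ContinuousOn (fun p : ℝ × ℝ =>
      ((1 + |A - (B + Q (p.1 / T)) * p.1 - b p.2 (p.1 / T) * p.1 ^ 3|) ^ K)⁻¹)
      (Icc (-T) T ×ˢ (univ : Set ℝ)) := by
    have h := (((continuousOn_const (c := A)).sub (((continuousOn_const (c := B)).add hQ').mul
      continuousOn_fst)).sub (hb'.mul (continuousOn_fst.pow 3))).abs
    exact (((continuousOn_const (c := (1 : ℝ))).add h).pow K).inv₀ fun p _ => by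
      simp only [Pi.pow_apply, Pi.add_apply]; positivity
  rw [hμ]
  refine ENNReal.measurable_ofReal.comp_aemeasurable
    ((hg.aemeasurable (measurableSet_Icc.prod MeasurableSet.univ)).mul ?_)
  exact (measurable_fst.abs.pow_const ϵ).aemeasurable

/-- a van der Corput type sublevel-integral estimate on `ℝ²`, uniform in the
data `b, Q, r₁, r₂` and in `A, B, T`. -/
theorem stmt18 (c c₁ c₂ a ϵ : ℝ) (hc : 0 < c) (hc₁ : 0 < c₁) (hc₂ : 0 < c₂)
    (ha : 0 < a) (hϵ : 0 ≤ ϵ) :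
    ∃ N₀ : ℕ, ∀ N : ℕ, N₀ ≤ N →
      ∃ C : ℝ, 0 < C ∧ ∃ ε₀ : ℝ, 0 < ε₀ ∧
        ∀ (b : ℝ → ℝ → ℝ) (Q r₁ r₂ : ℝ → ℝ) (A B T : ℝ),
          ContDiffOn ℝ 2 (fun p : ℝ × ℝ => b p.1 p.2) (univ ×ˢ Icc (-1:ℝ) 1) →
          a ≤ |b 0 0| →
          (∀ y₁ : ℝ, ∀ i ≤ 2, ∀ y₂ ∈ Icc (-1:ℝ) 1,
            |iteratedDerivWithin i (b y₁) (Icc (-1:ℝ) 1) y₂| ≤ c₁) →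
          (∀ y₁ : ℝ, ∀ y₂ ∈ Icc (-1:ℝ) 1, |b y₁ y₂ - b 0 0| ≤ ε₀) →
          (∀ y₁ : ℝ, ∀ y₂ ∈ Icc (-1:ℝ) 1, ∀ j : ℕ, j = 1 ∨ j = 2 →
            c₂ * |y₂| ^ (3 - (j:ℝ)) ≤
              |iteratedDerivWithin j (fun t => b y₁ t * t ^ 3) (Icc (-1:ℝ) 1) y₂|) →
          ContDiffOn ℝ 2 Q (Icc (-1:ℝ) 1) →
          (∀ i ≤ 2, ∀ y ∈ Icc (-1:ℝ) 1, |iteratedDerivWithin i Q (Icc (-1:ℝ) 1) y| ≤ c₁) →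
          Measurable r₁ → Measurable r₂ →
          (∀ y₁, |r₁ y₁| ≤ c * (1 + |y₁|)) → (∀ y₁, |r₂ y₁| ≤ c * (1 + |y₁|)) →
          C ≤ T → C ≤ max |A| |B| → |A| ≤ T ^ 3 → |B| ≤ T ^ 2 →
          (∫ y₂ in Icc (-T) T, ∫ y₁ : ℝ,
              (1 + |A - (B + Q (y₂ / T)) * y₂ - b y₁ (y₂ / T) * y₂ ^ 3
                  + r₁ y₁ + y₂ / T * r₂ y₁|) ^ (-(N:ℝ))
                * (1 + |y₁|) ^ (-(N:ℝ)) * |y₂| ^ ϵ)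
            ≤ C * (max (|A| ^ ((1:ℝ)/3)) (|B| ^ ((1:ℝ)/2))) ^ (ϵ - 1/2) := by
  obtain ⟨K, hKϵ⟩ : ∃ K : ℕ, ϵ + 2 ≤ K := exists_nat_ge _
  have hK : 2 ≤ K := by
    have : (2 : ℝ) ≤ K := by linarith
    exact_mod_cast this
  obtain ⟨C₀, hC₀, M₀, hM₀, H⟩ := exists_setLIntegral_phase_le hc₁ hc₂ (half_pos ha) hϵ hK
    (by linarith : ϵ ≤ K)
  refine ⟨K + 2, fun N hN => ⟨max (M₀ ^ 3) ((1 + 2 * c) ^ K * Real.pi * C₀), ?_, a / 2,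
    half_pos ha, ?_⟩⟩
  · exact lt_max_of_lt_left (by positivity)
  intro b Q r₁ r₂ A B T hb hb0 hbc hbε hβ hQ hQc _ _ hr₁ hr₂ hT hAB _ _
  obtain ⟨M, hM⟩ : ∃ M, M = max (|A| ^ ((1:ℝ)/3)) (|B| ^ ((1:ℝ)/2)) := ⟨_, rfl⟩
  rw [← hM]
  have hM₀3 : M₀ ^ 3 ≤ max |A| |B| := (le_max_left _ _).trans hAB
  have hT1 : 1 ≤ T := (one_le_pow₀ hM₀).trans ((le_max_left _ _).trans hT)
  have hT0 : 0 < T := by linarith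
  have hA3 : (|A| ^ ((1:ℝ)/3)) ^ 3 = |A| := by
    rw [← Real.rpow_natCast, ← Real.rpow_mul (abs_nonneg _)]; norm_num
  have hB2 : (|B| ^ ((1:ℝ)/2)) ^ 2 = |B| := by
    rw [← Real.rpow_natCast, ← Real.rpow_mul (abs_nonneg _)]; norm_num
  have hAM : |A| ^ ((1:ℝ)/3) ≤ M := hM ▸ le_max_left _ _
  have hBM : |B| ^ ((1:ℝ)/2) ≤ M := hM ▸ le_max_right _ _
  have hA : |A| ≤ M ^ 3 := by
    rw [← hA3]; gcongr
  have hB : |B| ≤ M ^ 2 := by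
    rw [← hB2]; gcongr
  have hABM : |A| = M ^ 3 ∨ |B| = M ^ 2 := by
    rcases max_choice (|A| ^ ((1:ℝ)/3)) (|B| ^ ((1:ℝ)/2)) with h | h
    · left; rw [hM, h, hA3]
    · right; rw [hM, h, hB2]
  have hMM₀ : M₀ ≤ M := by
    rcases le_max_iff.1 hM₀3 with h | h
    · refine le_trans (le_of_pow_le_pow_left₀ three_ne_zero (by positivity) ?_) hAM
      rwa [hA3]
    · refine le_trans (le_of_pow_le_pow_left₀ two_ne_zero (by positivity) ?_) hBM
      rw [hB2]
      exact (pow_le_pow_right₀ hM₀ (by norm_num)).trans h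
  have hM0 : 0 < M := by linarith
  have hD : M ^ ϵ / √M = M ^ (ϵ - 1 / 2) := by
    rw [Real.sqrt_eq_rpow, Real.rpow_sub hM0]
  obtain ⟨w, hw⟩ : ∃ w : ℝ → ℝ → ℝ, w = fun y₂ y₁ =>
      ((1 + |A - (B + Q (y₂ / T)) * y₂ - b y₁ (y₂ / T) * y₂ ^ 3|) ^ K)⁻¹ * |y₂| ^ ϵ := ⟨_, rfl⟩
  have hslice : ∀ y₁, ∫⁻ y₂ in Icc (-T) T, ENNReal.ofReal (w y₂ y₁)
      ≤ ENNReal.ofReal (C₀ * M ^ (ϵ - 1 / 2)) := by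
    intro y₁
    rw [hw, ← hD]
    refine H (b y₁) Q A B T M hT1 hMM₀ hA hB hABM ?_ (hbc y₁) ?_ ?_ hQ hQc
    · exact hb.comp (f := fun t : ℝ => (y₁, t)) (by fun_prop) fun t ht => ⟨mem_univ _, ht⟩
    · intro t ht
      have h1 := hbε y₁ t ht
      have h2 : |b 0 0| ≤ |b y₁ t - b 0 0| + |b y₁ t| := by
        calc |b 0 0| = |(b y₁ t - b 0 0) - b y₁ t| := by rw [← abs_neg]; congr 1; ring
          _ ≤ _ := abs_sub _ _
      linarith
    · intro t ht
      have h := hβ y₁ t ht 2 (Or.inr rfl)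
      norm_num at h
      exact h
  have hmeas : AEMeasurable (Function.uncurry fun y₂ y₁ =>
      ENNReal.ofReal ((1 + 2 * c) ^ K * (1 + y₁ ^ 2)⁻¹) * ENNReal.ofReal (w y₂ y₁))
      ((volume.restrict (Icc (-T) T)).prod volume) := by
    have h1 : Measurable fun p : ℝ × ℝ =>
      ENNReal.ofReal ((1 + 2 * c) ^ K * (1 + p.2 ^ 2)⁻¹) := by fun_prop
    rw [hw]
    exact h1.aemeasurable.mul (aemeasurable_phase_weight hT0 hb.continuousOn hQ.continuousOn)
  have hpt : ∀ y₂ ∈ Icc (-T) T, ∀ y₁,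
      ‖(1 + |A - (B + Q (y₂ / T)) * y₂ - b y₁ (y₂ / T) * y₂ ^ 3
                  + r₁ y₁ + y₂ / T * r₂ y₁|) ^ (-(N:ℝ))
                * (1 + |y₁|) ^ (-(N:ℝ)) * |y₂| ^ ϵ‖ₑ
      ≤ ENNReal.ofReal ((1 + 2 * c) ^ K * (1 + y₁ ^ 2)⁻¹) * ENNReal.ofReal (w y₂ y₁) := by
    intro y₂ hy₂ y₁
    rw [Real.enorm_of_nonneg (by positivity), ← ENNReal.ofReal_mul (by positivity)]
    apply ENNReal.ofReal_le_ofReal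
    rw [hw, Real.rpow_neg (by positivity), Real.rpow_neg (by positivity), Real.rpow_natCast,
      Real.rpow_natCast, ← mul_assoc, add_assoc]
    refine mul_le_mul_of_nonneg_right (perturbed_weight_le hN hc ?_) (by positivity)
    have h1 : |y₂ / T| ≤ 1 := abs_le.2 (div_mem_Icc_neg_one_one hT0 hy₂)
    calc |r₁ y₁ + y₂ / T * r₂ y₁| ≤ |r₁ y₁| + |y₂ / T| * |r₂ y₁| := by
          rw [← abs_mul]; exact abs_add_le _ _
      _ ≤ c * (1 + |y₁|) + 1 * (c * (1 + |y₁|)) := by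
          gcongr
          · exact hr₁ y₁
          · exact hr₂ y₁
      _ = _ := by ring
  rw [← ENNReal.ofReal_le_ofReal_iff (by positivity)]
  calc _ ≤ ‖_‖ₑ := by rw [← ofReal_norm]; exact ENNReal.ofReal_le_ofReal (Real.le_norm_self _)
    _ ≤ _ := enorm_integral_le_lintegral_enorm _
    _ ≤ ∫⁻ y₂ in Icc (-T) T, ∫⁻ y₁,
        ENNReal.ofReal ((1 + 2 * c) ^ K * (1 + y₁ ^ 2)⁻¹) * ENNReal.ofReal (w y₂ y₁) :=
      setLIntegral_mono' measurableSet_Icc fun y₂ hy₂ =>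
        (enorm_integral_le_lintegral_enorm _).trans (lintegral_mono (hpt y₂ hy₂))
    _ = ∫⁻ y₁, ∫⁻ y₂ in Icc (-T) T,
        ENNReal.ofReal ((1 + 2 * c) ^ K * (1 + y₁ ^ 2)⁻¹) * ENNReal.ofReal (w y₂ y₁) :=
      lintegral_lintegral_swap hmeas
    _ ≤ ∫⁻ y₁ : ℝ, ENNReal.ofReal ((1 + 2 * c) ^ K * (C₀ * M ^ (ϵ - 1 / 2)))
          * ENNReal.ofReal ((1 + y₁ ^ 2)⁻¹) := by
      refine lintegral_mono fun y₁ => ?_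
      rw [lintegral_const_mul' _ _ ENNReal.ofReal_ne_top, ENNReal.ofReal_mul (by positivity),
        ENNReal.ofReal_mul (by positivity), mul_right_comm]
      gcongr
      exact hslice y₁
    _ = ENNReal.ofReal ((1 + 2 * c) ^ K * Real.pi * C₀ * M ^ (ϵ - 1 / 2)) := by
      rw [lintegral_const_mul' _ _ ENNReal.ofReal_ne_top, lintegral_inv_one_add_sq,
        ← ENNReal.ofReal_mul (by positivity)]
      congr 1; ring
    _ ≤ _ := by
      apply ENNReal.ofReal_le_ofReal
      gcongr
      exact le_max_right _ _
end

section
/- Let c₁ ≥ a > 0, let ρ be a Schwartz function on ℝ and let χ₀ ∈ C_c^∞(ℝ) be nonnegative and supported in [−1,1]. Then there exist δ₀ ∈ (0,1), L ≥ 1 and a constant C, depending only on c₁, a, ρ and χ₀, such that the following holds: for every C² function b on [−1,1] with |b(0)| ≥ a and ‖b‖_{C²([−1,1])} ≤ c₁, all real numbers A and B, every T ≥ L and every δ ∈ (0,1) with δT ≤ δ₀, the integral I(A,B) := ∫_ℝ |ρ(A + By + b(δy)·y³)| · χ₀(y/T) dy satisfies I(A,B) ≤ C · (1 + max{|A|^{1/3},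 |B|^{1/2}})^{−1/2}. -/
open MeasureTheory Set

theorem mul_sub_le_sub_of_le_hasDerivAt {f f' : ℝ → ℝ} {m x y : ℝ} (hxy : x ≤ y)
    (hf : ∀ z ∈ Icc x y, HasDerivAt f (f' z) z) (hm : ∀ z ∈ Icc x y, m ≤ f' z) :
    m * (y - x) ≤ f y - f x := by
  refine (convex_Icc x y).mul_sub_le_image_sub_of_le_deriv
    (fun z hz => (hf z hz).continuousAt.continuousWithinAt)
    (fun z hz => (hf z (interior_subset hz)).differentiableAt.differentiableWithinAt)
    (fun z hz => ?_) x (left_mem_Icc.2 hxy) y (right_mem_Icc.2 hxy) hxy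
  rw [(hf z (interior_subset hz)).deriv]
  exact hm z (interior_subset hz)

theorem volume_sublevel_le_of_expanding {f : ℝ → ℝ} {J : Set ℝ} {m s : ℝ} (hm : 0 < m)
    (h : ∀ x ∈ J, ∀ y ∈ J, x ≤ y → m * (y - x) ≤ f y - f x) :
    volume (J ∩ {x | |f x| ≤ s}) ≤ ENNReal.ofReal (2 * s / m) := by
  refine (Real.volume_le_diam _).trans (Metric.ediam_le ?_)
  have key : ∀ x ∈ J ∩ {x | |f x| ≤ s}, ∀ y ∈ J ∩ {x | |f x| ≤ s}, x ≤ y →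
      |x - y| ≤ 2 * s / m := by
    intro x hx y hy hxy
    have h1 := h x hx.1 y hy.1 hxy
    have h2 := abs_le.1 (show |f x| ≤ s from hx.2)
    have h3 := abs_le.1 (show |f y| ≤ s from hy.2)
    rw [abs_sub_comm, abs_of_nonneg (sub_nonneg.2 hxy), le_div_iff₀ hm]
    linarith
  intro x hx y hy
  rw [edist_dist, Real.dist_eq]
  apply ENNReal.ofReal_le_ofReal
  rcases le_total x y with hxy | hxy
  · exact key x hx y hy hxy
  · rw [abs_sub_comm]; exact key y hy x hx hxy

theorem volume_sublevel_le_of_le_deriv {f f' : ℝ → ℝ} {J : Set ℝ} (hJ : J.OrdConnected) {m s : ℝ}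
    (hm : 0 < m) (hf : ∀ x ∈ J, HasDerivAt f (f' x) x) (h : ∀ x ∈ J, m ≤ f' x) :
    volume (J ∩ {x | |f x| ≤ s}) ≤ ENNReal.ofReal (2 * s / m) :=
  volume_sublevel_le_of_expanding hm fun _ hx _ hy hxy =>
    mul_sub_le_sub_of_le_hasDerivAt hxy (fun z hz => hf z (hJ.out hx hy hz))
      fun z hz => h z (hJ.out hx hy hz)

theorem volume_sublevel_le_of_deriv_le_neg {f f' : ℝ → ℝ} {J : Set ℝ} (hJ : J.OrdConnected)
    {m s : ℝ} (hm : 0 < m) (hf : ∀ x ∈ J, HasDerivAt f (f' x) x) (h : ∀ x ∈ J, f' x ≤ -m) :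
    volume (J ∩ {x | |f x| ≤ s}) ≤ ENNReal.ofReal (2 * s / m) := by
  have := volume_sublevel_le_of_le_deriv (f := fun x => -f x) (f' := fun x => -f' x) (s := s) hJ hm
    (fun x hx => (hf x hx).neg) (fun x hx => by linarith [h x hx])
  simpa only [abs_neg] using this

theorem volume_sublevel_le_of_le_second_deriv {f f' f'' : ℝ → ℝ} {J : Set ℝ}
    (hJ : J.OrdConnected) {m s : ℝ} (hm : 0 < m) (hs : 0 < s)
    (hf : ∀ x ∈ J, HasDerivAt f (f' x) x) (hf' : ∀ x ∈ J, HasDerivAt f' (f'' x) x)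
    (h : ∀ x ∈ J, m ≤ f'' x) :
    volume (J ∩ {x | |f x| ≤ s}) ≤ ENNReal.ofReal (6 * √(s / m)) := by
  set r := √(s / m) with hr
  have hr0 : 0 < r := Real.sqrt_pos.2 (div_pos hs hm)
  have hr2 : r ^ 2 = s / m := Real.sq_sqrt (div_pos hs hm).le
  have hsm : s = m * r ^ 2 := by rw [hr2]; field_simp
  have hmono : ∀ x ∈ J, ∀ y ∈ J, x ≤ y → f' x ≤ f' y := by
    intro x hx y hy hxy
    have := mul_sub_le_sub_of_le_hasDerivAt hxy (fun z hz => hf' z (hJ.out hx hy hz))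
      fun z hz => h z (hJ.out hx hy hz)
    nlinarith [mul_nonneg hm.le (sub_nonneg.2 hxy)]
  have hup : (J ∩ {x | m * r ≤ f' x}).OrdConnected := by
    refine ⟨fun x hx y hy z hz => ?_⟩
    have hzJ := hJ.out hx.1 hy.1 hz
    exact ⟨hzJ, le_trans hx.2 (hmono x hx.1 z hzJ hz.1)⟩
  have hdown : (J ∩ {x | f' x ≤ -(m * r)}).OrdConnected := by
    refine ⟨fun x hx y hy z hz => ?_⟩
    have hzJ := hJ.out hx.1 hy.1 hz
    exact ⟨hzJ, le_trans (hmono z hzJ y hy.1 hz.2) hy.2⟩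
  have v1 : volume (J ∩ {x | |f' x| ≤ m * r}) ≤ ENNReal.ofReal (2 * r) := by
    refine (volume_sublevel_le_of_le_deriv hJ hm hf' h).trans_eq ?_
    congr 1; field_simp
  have v2 : volume ((J ∩ {x | m * r ≤ f' x}) ∩ {x | |f x| ≤ s}) ≤ ENNReal.ofReal (2 * r) := by
    refine (volume_sublevel_le_of_le_deriv hup (mul_pos hm hr0) (fun x hx => hf x hx.1)
      fun x hx => hx.2).trans_eq ?_
    congr 1; rw [hsm]; field_simp
  have v3 : volume ((J ∩ {x | f' x ≤ -(m * r)}) ∩ {x | |f x| ≤ s}) ≤ ENNReal.ofReal (2 * r) := by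
    refine (volume_sublevel_le_of_deriv_le_neg hdown (mul_pos hm hr0) (fun x hx => hf x hx.1)
      fun x hx => hx.2).trans_eq ?_
    congr 1; rw [hsm]; field_simp
  have hsub : J ∩ {x | |f x| ≤ s} ⊆ (J ∩ {x | |f' x| ≤ m * r}) ∪
      ((J ∩ {x | m * r ≤ f' x}) ∩ {x | |f x| ≤ s}) ∪
      ((J ∩ {x | f' x ≤ -(m * r)}) ∩ {x | |f x| ≤ s}) := by
    rintro x ⟨hxJ, hxs⟩
    rcases le_total (m * r) (f' x) with h1 | h1
    · exact Or.inl (Or.inr ⟨⟨hxJ, h1⟩, hxs⟩)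
    · rcases le_total (f' x) (-(m * r)) with h2 | h2
      · exact Or.inr ⟨⟨hxJ, h2⟩, hxs⟩
      · exact Or.inl (Or.inl ⟨hxJ, abs_le.2 ⟨h2, h1⟩⟩)
  calc volume (J ∩ {x | |f x| ≤ s})
      ≤ ENNReal.ofReal (2 * r) + ENNReal.ofReal (2 * r) + ENNReal.ofReal (2 * r) :=
        (measure_mono hsub).trans <| (measure_union_le _ _).trans <|
          add_le_add ((measure_union_le _ _).trans (add_le_add v1 v2)) v3
    _ = ENNReal.ofReal (6 * r) := by
        rw [← ENNReal.ofReal_add (by positivity) (by positivity),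
          ← ENNReal.ofReal_add (by positivity) (by positivity)]
        congr 1; ring

theorem integral_le_of_sublevel {g φ : ℝ → ℝ} {S : Set ℝ} {K D : ℝ} (hK : 0 ≤ K) (hD : 0 ≤ D)
    (hg0 : ∀ y ∉ S, g y = 0) (hg : ∀ y, (1 + |φ y|) ^ 3 * |g y| ≤ K)
    (hvol : ∀ t, 1 ≤ t → volume (S ∩ {y | |φ y| ≤ t}) ≤ ENNReal.ofReal (D * t)) :
    ∫ y, g y ≤ K * D * ∑' n : ℕ, 1 / ((n : ℝ) + 1) ^ 2 := by
  have hsum : Summable fun n : ℕ => 1 / ((n : ℝ) + 1) ^ 2 := by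
    have := (summable_nat_add_iff 1).2 (Real.summable_one_div_nat_pow.2 (one_lt_two))
    simpa using this
  set E : ℕ → Set ℝ := fun n => toMeasurable volume (S ∩ {y | |φ y| ≤ (n : ℝ) + 1}) with hE
  have hpt : ∀ y, ENNReal.ofReal ‖g y‖ ≤
      ∑' n : ℕ, (E n).indicator (fun _ => ENNReal.ofReal (K / ((n : ℝ) + 1) ^ 3)) y := by
    intro y
    by_cases hy : y ∈ S
    · set n := ⌊|φ y|⌋₊
      have hn : (n : ℝ) ≤ |φ y| := Nat.floor_le (abs_nonneg _)
      have hn' : |φ y| ≤ (n : ℝ) + 1 := (Nat.lt_floor_add_one _).le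
      refine le_trans ?_ (ENNReal.le_tsum n)
      have hyE : y ∈ E n := subset_toMeasurable volume _ ⟨hy, hn'⟩
      rw [indicator_of_mem hyE]
      apply ENNReal.ofReal_le_ofReal
      rw [le_div_iff₀ (by positivity), Real.norm_eq_abs, mul_comm]
      refine le_trans ?_ (hg y)
      exact mul_le_mul_of_nonneg_right (pow_le_pow_left₀ (by positivity) (by linarith) 3)
        (abs_nonneg _)
    · simp [hg0 y hy]
  have hint : ∫⁻ y, ENNReal.ofReal ‖g y‖ ≤
      ENNReal.ofReal (K * D * ∑' n : ℕ, 1 / ((n : ℝ) + 1) ^ 2) := by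
    calc ∫⁻ y, ENNReal.ofReal ‖g y‖
        ≤ ∫⁻ y, ∑' n : ℕ,
            (E n).indicator (fun _ => ENNReal.ofReal (K / ((n : ℝ) + 1) ^ 3)) y :=
          lintegral_mono hpt
      _ = ∑' n : ℕ, ENNReal.ofReal (K / ((n : ℝ) + 1) ^ 3) * volume (E n) := by
          rw [lintegral_tsum fun n =>
            (measurable_const.indicator (measurableSet_toMeasurable _ _)).aemeasurable]
          exact tsum_congr fun n =>
            lintegral_indicator_const (measurableSet_toMeasurable _ _) _
      _ ≤ ∑' n : ℕ, ENNReal.ofReal (K * D * (1 / ((n : ℝ) + 1) ^ 2)) := by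
          refine ENNReal.tsum_le_tsum fun n => ?_
          calc ENNReal.ofReal (K / ((n : ℝ) + 1) ^ 3) * volume (E n)
              ≤ ENNReal.ofReal (K / ((n : ℝ) + 1) ^ 3) * ENNReal.ofReal (D * ((n : ℝ) + 1)) := by
                gcongr
                rw [hE, measure_toMeasurable]
                exact hvol _ (by linarith [n.cast_nonneg (α := ℝ)])
            _ = ENNReal.ofReal (K * D * (1 / ((n : ℝ) + 1) ^ 2)) := by
                rw [← ENNReal.ofReal_mul (by positivity)]
                congr 1; field_simp
      _ = ENNReal.ofReal (K * D * ∑' n : ℕ, 1 / ((n : ℝ) + 1) ^ 2) := by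
          rw [← ENNReal.ofReal_tsum_of_nonneg (fun n => by positivity) (hsum.mul_left _),
            tsum_mul_left]
  calc ∫ y, g y ≤ ‖∫ y, g y‖ := Real.le_norm_self _
    _ ≤ (∫⁻ y, ENNReal.ofReal ‖g y‖).toReal := norm_integral_le_lintegral_norm g
    _ ≤ _ := ENNReal.toReal_le_of_le_ofReal
        (mul_nonneg (mul_nonneg hK hD) (tsum_nonneg fun n => by positivity)) hint

theorem half_cube_le_abs_cubic {A B β y c r M : ℝ} (hM : 0 ≤ M) (hr : 0 ≤ r) (hr4 : r ≤ 1 / 4)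
    (hrc : r * c ≤ 1 / 4) (hA : |A| = M ^ 3) (hB : |B| ≤ M ^ 2) (hβ : |β| ≤ c)
    (hy : |y| ≤ r * M) : M ^ 3 / 2 ≤ |A + B * y + β * y ^ 3| := by
  have hc : 0 ≤ c := (abs_nonneg _).trans hβ
  have k1 : |B * y| ≤ M ^ 3 / 4 := by
    rw [abs_mul]
    calc |B| * |y| ≤ M ^ 2 * (r * M) := by gcongr
      _ = r * M ^ 3 := by ring
      _ ≤ 1 / 4 * M ^ 3 := by gcongr
      _ = M ^ 3 / 4 := by ring
  have k2 : |β * y ^ 3| ≤ M ^ 3 / 4 := by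
    rw [abs_mul, abs_pow]
    calc |β| * |y| ^ 3 ≤ c * (r * M) ^ 3 := by gcongr
      _ = (r * c) * r * r * M ^ 3 := by ring
      _ ≤ (1 / 4) * (1 / 4) * (1 / 4) * M ^ 3 := by gcongr
      _ ≤ M ^ 3 / 4 := by nlinarith [pow_nonneg hM 3]
  have h1 := abs_sub (A + B * y + β * y ^ 3 - B * y) (β * y ^ 3)
  have h2 := abs_sub (A + B * y + β * y ^ 3) (B * y)
  rw [show A + B * y + β * y ^ 3 - B * y - β * y ^ 3 = A by ring] at h1
  linarith

theorem abs_add_mul_sq_le {β γ u y c r M : ℝ} (hr : 0 ≤ r) (hr4 : r ≤ 1 / 4)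
    (hrc : r * c ≤ 1 / 4) (hβ : |β| ≤ c) (hγ : |γ| ≤ c) (hu : |u| ≤ 1) (hy : |y| ≤ r * M) :
    |(3 * β + u * γ) * y ^ 2| ≤ M ^ 2 / 2 := by
  have hc : 0 ≤ c := (abs_nonneg _).trans hβ
  have h : |3 * β + u * γ| ≤ 4 * c := by
    refine (abs_add_le _ _).trans ?_
    rw [abs_mul, abs_mul, abs_of_pos (by norm_num : (0 : ℝ) < 3)]
    have := mul_le_mul hu hγ (abs_nonneg _) zero_le_one
    linarith
  rw [abs_mul, abs_pow]
  calc |3 * β + u * γ| * |y| ^ 2 ≤ (4 * c) * (r * M) ^ 2 := by gcongr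
    _ = 4 * (r * c) * r * M ^ 2 := by ring
    _ ≤ 4 * (1 / 4) * (1 / 4) * M ^ 2 := by gcongr
    _ ≤ M ^ 2 / 2 := by nlinarith [sq_nonneg M]

theorem volume_cubic_sublevel_le {a c₁ : ℝ} (ha : 0 < a) (hac : a ≤ c₁) {b b₁ b₂ : ℝ → ℝ}
    (h0 : a ≤ b 0) (hd : ∀ x ∈ Ioo (-1 : ℝ) 1, HasDerivAt b (b₁ x) x)
    (hd₁ : ∀ x ∈ Ioo (-1 : ℝ) 1, HasDerivAt b₁ (b₂ x) x)
    (hb : ∀ x ∈ Ioo (-1 : ℝ) 1, |b x| ≤ c₁) (hb₁ : ∀ x ∈ Ioo (-1 : ℝ) 1, |b₁ x| ≤ c₁)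
    (hb₂ : ∀ x ∈ Ioo (-1 : ℝ) 1, |b₂ x| ≤ c₁) {A B M T δ s : ℝ} (hM : 0 ≤ M)
    (hB : |B| ≤ M ^ 2) (hAB : |A| = M ^ 3 ∨ |B| = M ^ 2)
    (hδ : 0 < δ) (hδT : δ * T ≤ a / (4 * c₁)) (hs : 1 ≤ s) :
    volume (Icc (-T) T ∩ {y | |A + B * y + b (δ * y) * y ^ 3| ≤ s}) ≤
      ENNReal.ofReal ((8 + 24 / √(a / (4 * (1 + c₁)))) / √(1 + M) * s) := by
  have hc : 0 < c₁ := ha.trans_le hac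
  set φ : ℝ → ℝ := fun y => A + B * y + b (δ * y) * y ^ 3 with hφ
  set φ₁ : ℝ → ℝ := fun y => B + (3 * b (δ * y) * y ^ 2 + δ * b₁ (δ * y) * y ^ 3) with hφ₁
  set φ₂ : ℝ → ℝ := fun y =>
    y * (6 * b (δ * y) + 6 * (δ * y) * b₁ (δ * y) + (δ * y) ^ 2 * b₂ (δ * y)) with hφ₂
  set e := a / (4 * c₁) with he
  have he0 : 0 < e := by positivity
  have hec : e * c₁ = a / 4 := by rw [he]; field_simp
  have he4 : e ≤ 1 / 4 := by
    rw [he, div_le_iff₀ (by positivity)]; linarith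
  have hu : ∀ y ∈ Icc (-T) T, |δ * y| ≤ e := by
    intro y hy
    rw [abs_mul, abs_of_pos hδ]
    exact (mul_le_mul_of_nonneg_left (abs_le.2 hy) hδ.le).trans hδT
  have huI : ∀ y ∈ Icc (-T) T, δ * y ∈ Ioo (-1 : ℝ) 1 := fun y hy => by
    have := abs_le.1 (hu y hy)
    constructor <;> linarith
  have hφd : ∀ y ∈ Icc (-T) T, HasDerivAt φ (φ₁ y) y := by
    intro y hy
    have hl : HasDerivAt (fun y => δ * y) δ y := by
      simpa using (hasDerivAt_id y).const_mul δ
    have h1 := (hd _ (huI y hy)).comp y hl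
    have h2 := (((hasDerivAt_id y).const_mul B).const_add A).add
      (h1.mul (hasDerivAt_pow 3 y))
    refine h2.congr_deriv ?_
    simp only [hφ₁, Function.comp]
    push_cast
    ring
  have hφd₁ : ∀ y ∈ Icc (-T) T, HasDerivAt φ₁ (φ₂ y) y := by
    intro y hy
    have hl : HasDerivAt (fun y => δ * y) δ y := by
      simpa using (hasDerivAt_id y).const_mul δ
    have h1 := (hd _ (huI y hy)).comp y hl
    have h1' := (hd₁ _ (huI y hy)).comp y hl
    have h2 := (((h1.const_mul 3).mul (hasDerivAt_pow 2 y)).add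
      ((h1'.const_mul δ).mul (hasDerivAt_pow 3 y))).const_add B
    refine h2.congr_deriv ?_
    simp only [hφ₂, Function.comp]
    push_cast
    ring
  have hquot : ∀ y ∈ Icc (-T) T,
      a ≤ 6 * b (δ * y) + 6 * (δ * y) * b₁ (δ * y) + (δ * y) ^ 2 * b₂ (δ * y) := by
    intro y hy
    have hI := huI y hy
    have hue := hu y hy
    set u := δ * y
    have k1 : |b u - b 0| ≤ c₁ * |u - 0| := by
      simpa only [Real.norm_eq_abs] using
        (convex_Ioo (-1 : ℝ) 1).norm_image_sub_le_of_norm_hasDerivWithin_le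
        (fun x hx => (hd x hx).hasDerivWithinAt) (fun x hx => hb₁ x hx)
        (by norm_num : (0 : ℝ) ∈ Ioo (-1 : ℝ) 1) hI
    rw [sub_zero] at k1
    have k1' : |b u - b 0| ≤ a / 4 := by nlinarith
    have k2 : |u * b₁ u| ≤ a / 4 := by
      rw [abs_mul, ← hec]
      exact mul_le_mul hue (hb₁ u hI) (abs_nonneg _) he0.le
    have k3 : |u ^ 2 * b₂ u| ≤ a / 4 := by
      have h1 : |u| ^ 2 ≤ e := by nlinarith [abs_nonneg u]
      rw [abs_mul, abs_pow, ← hec]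
      exact mul_le_mul h1 (hb₂ u hI) (abs_nonneg _) he0.le
    have := (abs_le.1 k1').1
    have := (abs_le.1 k2).1
    have := (abs_le.1 k3).1
    nlinarith
  have hfar : ∀ R, 0 < R → volume (Icc (-T) T ∩ {y | R ≤ |y|} ∩ {y | |φ y| ≤ s}) ≤
      ENNReal.ofReal (12 * √(s / (a * R))) := by
    intro R hR
    have vp : volume (Icc R T ∩ {y | |φ y| ≤ s}) ≤ ENNReal.ofReal (6 * √(s / (a * R))) := by
      have hsub : ∀ y ∈ Icc R T, y ∈ Icc (-T) T := fun y hy =>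
        ⟨by linarith [hy.1, hy.2], hy.2⟩
      refine volume_sublevel_le_of_le_second_deriv ordConnected_Icc (mul_pos ha hR) (by linarith)
        (fun y hy => hφd y (hsub y hy)) (fun y hy => hφd₁ y (hsub y hy)) fun y hy => ?_
      rw [mul_comm a R]
      exact mul_le_mul hy.1 (hquot y (hsub y hy)) ha.le (hR.le.trans hy.1)
    have vn : volume (Icc (-T) (-R) ∩ {y | |φ y| ≤ s}) ≤
        ENNReal.ofReal (6 * √(s / (a * R))) := by
      have hsub : ∀ y ∈ Icc (-T) (-R), y ∈ Icc (-T) T := fun y hy =>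
        ⟨hy.1, by linarith [hy.1, hy.2]⟩
      have := volume_sublevel_le_of_le_second_deriv (f := fun y => -φ y) (f' := fun y => -φ₁ y)
        (f'' := fun y => -φ₂ y) (J := Icc (-T) (-R)) (s := s)
        ordConnected_Icc (mul_pos ha hR) (by linarith)
        (fun y hy => (hφd y (hsub y hy)).neg) (fun y hy => (hφd₁ y (hsub y hy)).neg)
        fun y hy => by
          have hy2 : R ≤ -y := by linarith [hy.2]
          rw [mul_comm a R, ← neg_mul]
          exact mul_le_mul hy2 (hquot y (hsub y hy)) ha.le (hR.le.trans hy2)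
      simpa only [abs_neg] using this
    have hsub : Icc (-T) T ∩ {y | R ≤ |y|} ∩ {y | |φ y| ≤ s} ⊆
        (Icc R T ∩ {y | |φ y| ≤ s}) ∪ (Icc (-T) (-R) ∩ {y | |φ y| ≤ s}) := by
      rintro y ⟨⟨hy, hyR⟩, hys⟩
      rcases le_abs'.1 (show R ≤ |y| from hyR) with h | h
      · exact Or.inr ⟨⟨hy.1, h⟩, hys⟩
      · exact Or.inl ⟨⟨h, hy.2⟩, hys⟩
    refine (measure_mono hsub).trans <| (measure_union_le _ _).trans <|
      (add_le_add vp vn).trans_eq ?_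
    rw [← ENNReal.ofReal_add (by positivity) (by positivity)]
    congr 1; ring
  have hsplit : ∀ R V, 0 < R → 0 ≤ V →
      volume (Icc (-T) T ∩ Icc (-R) R ∩ {y | |φ y| ≤ s}) ≤ ENNReal.ofReal V →
      V + 12 * √(s / (a * R)) ≤ (8 + 24 / √(a / (4 * (1 + c₁)))) / √(1 + M) * s →
      volume (Icc (-T) T ∩ {y | |φ y| ≤ s}) ≤
        ENNReal.ofReal ((8 + 24 / √(a / (4 * (1 + c₁)))) / √(1 + M) * s) := by
    intro R V hR hV hvol hle
    have hsub : Icc (-T) T ∩ {y | |φ y| ≤ s} ⊆ (Icc (-T) T ∩ Icc (-R) R ∩ {y | |φ y| ≤ s}) ∪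
        (Icc (-T) T ∩ {y | R ≤ |y|} ∩ {y | |φ y| ≤ s}) := by
      rintro y ⟨hy, hys⟩
      rcases le_total R |y| with h | h
      · exact Or.inr ⟨⟨hy, h⟩, hys⟩
      · exact Or.inl ⟨⟨hy, abs_le.1 h⟩, hys⟩
    refine (measure_mono hsub).trans <| (measure_union_le _ _).trans <|
      (add_le_add hvol (hfar R hR)).trans ?_
    rw [← ENNReal.ofReal_add hV (by positivity)]
    exact ENNReal.ofReal_le_ofReal hle
  set q := √(a / (4 * (1 + c₁))) with hq
  have hq0 : 0 < q := Real.sqrt_pos.2 (by positivity)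
  have hs0 : 0 < √s := Real.sqrt_pos.2 (by linarith)
  have hss : √s * √s = s := Real.mul_self_sqrt (by linarith)
  have hs1 : 1 ≤ √s := Real.one_le_sqrt.2 hs
  have hM0 : 0 < √(1 + M) := Real.sqrt_pos.2 (by linarith)
  rcases le_or_gt (M ^ 3) (2 * s) with hMs | hMs
  · refine hsplit 1 2 one_pos (by norm_num) ?_ ?_
    · refine (measure_mono (t := Icc (-1 : ℝ) 1) fun y hy => hy.1.2).trans_eq ?_
      rw [Real.volume_Icc]; norm_num
    · have hM2 : M ≤ 2 * s := by
        rcases le_total M 1 with h | h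
        · linarith
        · nlinarith [sq_nonneg (M - 1), mul_nonneg hM (sub_nonneg.2 h)]
      have h1 : √(1 + M) ≤ 2 * √s := by
        rw [Real.sqrt_le_left (by positivity)]
        nlinarith
      have h2 : √(s / (a * 1)) ≤ √s / q := by
        rw [hq, ← Real.sqrt_div (by linarith)]
        apply Real.sqrt_le_sqrt
        gcongr
        rw [mul_one]
        exact div_le_self ha.le (by linarith)
      rw [div_mul_eq_mul_div, le_div_iff₀ hM0]
      have h3 : 0 ≤ √s / q := by positivity
      calc (2 + 12 * √(s / (a * 1))) * √(1 + M)
          ≤ (4 * √s + 12 * (√s / q)) * (2 * √s) := by gcongr; linarith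
        _ = (8 + 24 / q) * (√s * √s) := by ring
        _ = (8 + 24 / q) * s := by rw [hss]
  · have hM1 : 1 ≤ M := by
      by_contra! h
      have : M ^ 3 ≤ 1 := pow_le_one₀ hM h.le
      linarith
    set r := 1 / (4 * (1 + c₁)) with hr
    have hr0 : 0 < r := by positivity
    have hr4 : r ≤ 1 / 4 := by
      rw [hr]; apply one_div_le_one_div_of_le <;> linarith
    have hrc : r * c₁ ≤ 1 / 4 := by
      have : r * (1 + c₁) = 1 / 4 := by rw [hr]; field_simp
      linarith
    have hfin : 4 * s / M ^ 2 + 12 * √(s / (a * (r * M))) ≤ (8 + 24 / q) / √(1 + M) * s := by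
      have hsM : 0 < √M := Real.sqrt_pos.2 (by linarith)
      have h1 : √(1 + M) ≤ 2 * √M := by
        rw [Real.sqrt_le_left (by positivity), mul_pow, Real.sq_sqrt hM]
        linarith
      have h2 : √(s / (a * (r * M))) = √s / (q * √M) := by
        rw [Real.sqrt_div (by linarith), ← mul_assoc, Real.sqrt_mul (by positivity), hq, hr,
          mul_one_div]
      have h3 : √(1 + M) ≤ 2 * M ^ 2 := by
        rw [Real.sqrt_le_left (by positivity)]
        nlinarith [mul_nonneg (sub_nonneg.2 hM1) hM, sq_nonneg (M ^ 2 - 1)]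
      have h4 : √s ≤ s := by nlinarith
      rw [h2, div_mul_eq_mul_div, le_div_iff₀ hM0, add_mul, add_mul]
      gcongr ?_ + ?_
      · rw [div_mul_eq_mul_div, div_le_iff₀ (by positivity)]
        nlinarith
      · calc 12 * (√s / (q * √M)) * √(1 + M) ≤ 12 * (s / (q * √M)) * (2 * √M) := by gcongr
          _ = 24 / q * s := by field_simp; ring
    refine hsplit (r * M) (4 * s / M ^ 2) (by positivity) (by positivity) ?_ hfin
    have hoc : (Icc (-T) T ∩ Icc (-(r * M)) (r * M)).OrdConnected :=
      ordConnected_Icc.inter ordConnected_Icc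
    have hyM : ∀ y ∈ Icc (-(r * M)) (r * M), |y| ≤ r * M := fun y hy => abs_le.2 hy
    by_cases hBM : |B| = M ^ 2
    · have hpert : ∀ y ∈ Icc (-T) T ∩ Icc (-(r * M)) (r * M),
          |3 * b (δ * y) * y ^ 2 + δ * b₁ (δ * y) * y ^ 3| ≤ M ^ 2 / 2 := by
        intro y hy
        have hI := huI y hy.1
        have hy1 := hyM y hy.2
        have e1 : 3 * b (δ * y) * y ^ 2 + δ * b₁ (δ * y) * y ^ 3 =
          (3 * b (δ * y) + (δ * y) * b₁ (δ * y)) * y ^ 2 := by ring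
        rw [e1]
        exact abs_add_mul_sq_le hr0.le hr4 hrc (hb _ hI) (hb₁ _ hI)
          ((hu y hy.1).trans (he4.trans (by norm_num))) hy1
      have hval : 4 * s / M ^ 2 = 2 * s / (M ^ 2 / 2) := by field_simp; ring
      rw [hval]
      rcases abs_cases B with ⟨hB', -⟩ | ⟨hB', -⟩
      · refine volume_sublevel_le_of_le_deriv hoc (by positivity) (fun y hy => hφd y hy.1)
          fun y hy => ?_
        have := (abs_le.1 (hpert y hy)).1
        simp only [hφ₁]
        linarith
      · refine volume_sublevel_le_of_deriv_le_neg hoc (by positivity) (fun y hy => hφd y hy.1)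
          fun y hy => ?_
        have := (abs_le.1 (hpert y hy)).2
        simp only [hφ₁]
        linarith
    · have hA := hAB.resolve_right hBM
      have hempty : Icc (-T) T ∩ Icc (-(r * M)) (r * M) ∩ {y | |φ y| ≤ s} = ∅ := by
        refine eq_empty_of_forall_notMem fun y hy => ?_
        obtain ⟨⟨hyT, hyR⟩, hys⟩ := hy
        have hys' : |A + B * y + b (δ * y) * y ^ 3| ≤ s := hys
        have hy1 := hyM y hyR
        linarith [half_cube_le_abs_cubic hM hr0.le hr4 hrc hA hB (hb _ (huI y hyT)) hy1]
      rw [hempty, measure_empty]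
      exact zero_le

/-- uniform sublevel estimate for a cubic perturbed argument. For
`c₁ ≥ a > 0`, a Schwartz function `ρ` and a nonnegative smooth bump `χ₀` supported in
`[-1,1]`, there are `δ₀ ∈ (0,1)`, `L ≥ 1` and `C > 0` such that for every `C²` function
`b` on `[-1,1]` with `|b(0)| ≥ a` and `C²`-norm `≤ c₁`, all reals `A, B`, every `T ≥ L`
and `δ ∈ (0,1)` with `δT ≤ δ₀`,
`∫ |ρ(A + By + b(δy)y³)| χ₀(y/T) dy ≤ C (1 + max{|A|^{1/3}, |B|^{1/2}})^{-1/2}`. -/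
theorem stmt19 (c₁ a : ℝ) (ha : 0 < a) (hac : a ≤ c₁)
    (ρ : SchwartzMap ℝ ℝ) (χ₀ : ℝ → ℝ) (hχsm : ContDiff ℝ (⊤ : ℕ∞) χ₀)
    (hχnn : ∀ t, 0 ≤ χ₀ t) (hχsupp : Function.support χ₀ ⊆ Icc (-1 : ℝ) 1) :
    ∃ δ₀ : ℝ, δ₀ ∈ Ioo (0:ℝ) 1 ∧ ∃ L : ℝ, 1 ≤ L ∧ ∃ C : ℝ, 0 < C ∧
      ∀ b : ℝ → ℝ, ContDiffOn ℝ 2 b (Icc (-1:ℝ) 1) → a ≤ |b 0| →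
        (∀ i ≤ 2, ∀ y ∈ Icc (-1:ℝ) 1, |iteratedDerivWithin i b (Icc (-1:ℝ) 1) y| ≤ c₁) →
        ∀ A B T δ : ℝ, L ≤ T → 0 < δ → δ < 1 → δ * T ≤ δ₀ →
          (∫ y : ℝ, |ρ (A + B * y + b (δ * y) * y ^ 3)| * χ₀ (y / T))
            ≤ C * (1 + max (|A| ^ ((1:ℝ)/3)) (|B| ^ ((1:ℝ)/2))) ^ (-(1:ℝ)/2) := by
  have hc : 0 < c₁ := ha.trans_le hac
  obtain ⟨K, hK⟩ : ∃ K, ∀ x, (1 + |x|) ^ 3 * |ρ x| ≤ K :=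
    ⟨_, fun x => by
      simpa using SchwartzMap.one_add_le_sup_seminorm_apply (𝕜 := ℝ) (m := (3, 0))
        (k := 3) (n := 0) le_rfl le_rfl ρ x⟩
  obtain ⟨X, hX⟩ : ∃ X, ∀ t, χ₀ t ≤ X := by
    obtain ⟨X, hX⟩ := isCompact_Icc.exists_bound_of_continuousOn
      (hχsm.continuous.continuousOn (s := Icc (-1 : ℝ) 1))
    refine ⟨X, fun t => ?_⟩
    by_cases ht : t ∈ Icc (-1 : ℝ) 1
    · exact (Real.le_norm_self _).trans (hX t ht)
    · rw [Function.notMem_support.1 fun h => ht (hχsupp h)]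
      exact (norm_nonneg _).trans (hX 0 (by norm_num))
  have hK0 : 0 ≤ K := le_trans (by positivity) (hK 0)
  have hX0 : 0 ≤ X := (hχnn 0).trans (hX 0)
  set D := 8 + 24 / √(a / (4 * (1 + c₁))) with hD
  have hD0 : 0 ≤ D := by positivity
  set Z : ℝ := ∑' n : ℕ, 1 / ((n : ℝ) + 1) ^ 2 with hZ
  have hZ0 : 0 ≤ Z := tsum_nonneg fun n => by positivity
  refine ⟨a / (4 * c₁), ⟨by positivity, ?_⟩, 1, le_rfl, K * X * D * Z + 1, by positivity, ?_⟩
  · rw [div_lt_one (by positivity)]; linarith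
  intro b hbC hb0 hbd A B T δ hT hδ _ hδT
  set M := max (|A| ^ ((1:ℝ)/3)) (|B| ^ ((1:ℝ)/2)) with hMdef
  have hA3 : (|A| ^ ((1:ℝ)/3)) ^ 3 = |A| := by
    rw [← Real.rpow_natCast, ← Real.rpow_mul (abs_nonneg _)]; norm_num
  have hB2 : (|B| ^ ((1:ℝ)/2)) ^ 2 = |B| := by
    rw [← Real.rpow_natCast, ← Real.rpow_mul (abs_nonneg _)]; norm_num
  have hM : 0 ≤ M := le_max_of_le_left (by positivity)
  have hB : |B| ≤ M ^ 2 := by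
    rw [← hB2]; gcongr; exact le_max_right _ _
  have hAB : |A| = M ^ 3 ∨ |B| = M ^ 2 := by
    rcases max_choice (|A| ^ ((1:ℝ)/3)) (|B| ^ ((1:ℝ)/2)) with h | h
    · left; rw [hMdef, h, hA3]
    · right; rw [hMdef, h, hB2]
  have hpow : (1 + M) ^ (-(1:ℝ)/2) = 1 / √(1 + M) := by
    rw [neg_div, Real.rpow_neg (by linarith), ← Real.sqrt_eq_rpow, one_div]
  have hI : ∀ x ∈ Ioo (-1 : ℝ) 1, x ∈ Icc (-1 : ℝ) 1 := fun x hx => Ioo_subset_Icc_self hx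
  have hderiv : ∀ i < 2, ∀ x ∈ Ioo (-1 : ℝ) 1,
      HasDerivAt (iteratedDerivWithin i b (Icc (-1:ℝ) 1))
        (iteratedDerivWithin (i + 1) b (Icc (-1:ℝ) 1) x) x := by
    intro i hi x hx
    rw [iteratedDerivWithin_succ]
    have hdiff := hbC.differentiableOn_iteratedDerivWithin (m := i) (by exact_mod_cast hi)
      (uniqueDiffOn_Icc (by norm_num))
    exact (hdiff x (hI x hx)).hasDerivWithinAt.hasDerivAt (Icc_mem_nhds hx.1 hx.2)
  have hvol : ∀ t, 1 ≤ t →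
      volume (Icc (-T) T ∩ {y | |A + B * y + b (δ * y) * y ^ 3| ≤ t}) ≤
        ENNReal.ofReal (D / √(1 + M) * t) := by
    intro t ht
    have hd0 := hderiv 0 (by norm_num)
    have hd1 := hderiv 1 (by norm_num)
    have hn0 := fun x hx => hbd 0 (by norm_num) x (hI x hx)
    have hn1 := fun x hx => hbd 1 (by norm_num) x (hI x hx)
    have hn2 := fun x hx => hbd 2 (by norm_num) x (hI x hx)
    simp only [iteratedDerivWithin_zero, zero_add, one_add_one_eq_two] at hd0 hd1 hn0
    rcases le_abs.1 hb0 with h | h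
    · exact volume_cubic_sublevel_le ha hac h hd0 hd1 hn0 hn1 hn2 hM hB hAB hδ hδT ht
    · have := volume_cubic_sublevel_le (b := fun x => -b x) (A := -A) (B := -B) ha hac h
        (fun x hx => (hd0 x hx).neg) (fun x hx => (hd1 x hx).neg)
        (fun x hx => by rw [abs_neg]; exact hn0 x hx)
        (fun x hx => by rw [abs_neg]; exact hn1 x hx)
        (fun x hx => by rw [abs_neg]; exact hn2 x hx) hM
        (by rwa [abs_neg]) (by rwa [abs_neg, abs_neg]) hδ hδT ht
      refine Eq.trans_le ?_ this
      congr 3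
      ext y
      rw [← abs_neg]
      congr! 2
      ring
  have hT0 : 0 < T := by linarith
  have hmain := integral_le_of_sublevel
    (g := fun y => |ρ (A + B * y + b (δ * y) * y ^ 3)| * χ₀ (y / T))
    (φ := fun y => A + B * y + b (δ * y) * y ^ 3) (S := Icc (-T) T) (mul_nonneg hK0 hX0)
    (div_nonneg hD0 (Real.sqrt_nonneg _)) (fun y hy => ?_) (fun y => ?_) hvol
  · refine hmain.trans ?_
    rw [hpow]
    calc K * X * (D / √(1 + M)) * Z = K * X * D * Z * (1 / √(1 + M)) := by ring
      _ ≤ (K * X * D * Z + 1) * (1 / √(1 + M)) := by gcongr; linarith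
  · have : y / T ∉ Icc (-1 : ℝ) 1 := by
      rintro ⟨h1, h2⟩
      rw [le_div_iff₀ hT0] at h1
      rw [div_le_iff₀ hT0] at h2
      exact hy ⟨by linarith, by linarith⟩
    rw [Function.notMem_support.1 fun h => this (hχsupp h), mul_zero]
  · rw [abs_mul, abs_abs, abs_of_nonneg (hχnn _), ← mul_assoc]
    exact mul_le_mul (hK _) (hX _) (hχnn _) hK0
end
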